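/- There is a universal constant c₁ ≤ 10 such that the following holds. Let n ≥ 1 be an integer and let h, w be positive real numbers with w > 1 and h ≥ c₁·n⁴·log n + log w. Then among the points of the projective space ℙ(M_n(ℚ)) of bit length at most h (i.e. of Northcott–Schmidt height at most 2^h), the proportion of points P with condition number k(P) < w·n^{5/2} is at least 1 − 2/w; equivalently, #{P ∈ ℙ(M_n(ℚ)) : H(P) ≤ 2^h and k(P) ≥ w·n^{5/2}} ≤ (2/w)·#{P ∈ ℙ(M_n(ℚ)) : H(P) ≤ 2^h}. -/

import Mathlib

open scoped ENNReal

noncomputable section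

/-- Frobenius norm of a real matrix. -/
def frobNorm {n : ℕ} (M : Matrix (Fin n) (Fin n) ℝ) : ℝ :=
  Real.sqrt (∑ i, ∑ j, (M i j) ^ 2)

/-- Euclidean norm on `ℝ^n`. -/
def eNorm {n : ℕ} (v : Fin n → ℝ) : ℝ := Real.sqrt (∑ i, (v i) ^ 2)

/-- Operator norm of a real matrix. -/
def opNorm {n : ℕ} (M : Matrix (Fin n) (Fin n) ℝ) : ℝ :=
  sSup {t : ℝ | ∃ v : Fin n → ℝ, eNorm v = 1 ∧ t = eNorm (M.mulVec v)}

open Classical in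
/-- The condition number `k(M) = ‖M‖·‖M⁻¹‖`, with value `+∞` at singular matrices. -/
def kE {n : ℕ} (M : Matrix (Fin n) (Fin n) ℝ) : ℝ≥0∞ :=
  if IsUnit M.det then ENNReal.ofReal (opNorm M * opNorm M⁻¹) else ⊤

/-- The condition number of a rational projective point (computed on a representative;
`k` only depends on the projective class). -/
def kP {n : ℕ} (P : Projectivization ℚ (Matrix (Fin n) (Fin n) ℚ)) : ℝ≥0∞ :=
  kE ((Projectivization.rep P).map (Rat.cast : ℚ → ℝ))

/-- The point of `ℙ(M_n(ℚ))` has Northcott–Schmidt height at most `H` : it admits an integer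
matrix representative whose entries have greatest common divisor `1` and whose Frobenius norm
is at most `H`.  Bit length at most `h` means height at most `2^h`. -/
def heightLE {n : ℕ} (P : Projectivization ℚ (Matrix (Fin n) (Fin n) ℚ)) (H : ℝ) : Prop :=
  ∃ (A : Matrix (Fin n) (Fin n) ℤ) (h0 : (A.map (Int.cast : ℤ → ℚ)) ≠ 0),
    (Finset.univ.gcd (fun p : Fin n × Fin n => A p.1 p.2) = 1) ∧
    P = Projectivization.mk ℚ (A.map (Int.cast : ℤ → ℚ)) h0 ∧
    frobNorm (A.map (Int.cast : ℤ → ℝ)) ≤ H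

open scoped Classical in
/-- Double counting along the lines `v + ℤ b`: the number of points of a set whose `φ`-values lie in
`[-δ, δ]` is compared with the number of points in the window `[-Δ, Δ]`. -/
theorem card_window_le {G : Type*} [AddCommGroup G] (φ : G →+ ℝ) (b : G) (hb : 0 < φ b)
    {δ Δ : ℝ} (hδ : 0 ≤ δ) (S S' : Finset G) (hS : ∀ v ∈ S, |φ v| ≤ δ)
    (hS' : ∀ v ∈ S, ∀ t : ℤ, |φ (v + t • b)| ≤ Δ → v + t • b ∈ S') :
    (2 * Δ - φ b) * (S.card : ℝ) ≤ (2 * δ + φ b) * (S'.card : ℝ) := by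
  set s := φ b with hs
  have hφ : ∀ v (t : ℤ), φ (v + t • b) = φ v + t * s := by
    intro v t; simp [hs]
  have hinj : ∀ v : G, Function.Injective (fun t : ℤ => v + t • b) := by
    intro v t t' h
    have h1 : φ (v + t • b) = φ (v + t' • b) := congrArg φ h
    rw [hφ, hφ] at h1
    have h2 : (t : ℝ) = t' := mul_right_cancel₀ hb.ne' (by linarith)
    exact_mod_cast h2
  have key := Finset.card_nsmul_le_card_nsmul (R := ℝ) (fun v v' : G => ∃ t : ℤ, v' = v + t • b)
    (s := S) (t := S') (m := 2 * Δ / s - 1) (n := 2 * δ / s + 1) ?_ ?_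
  · simp only [nsmul_eq_mul] at key
    have h1 : (2 * Δ - s) = (2 * Δ / s - 1) * s := by field_simp
    have h2 : (2 * δ + s) = (2 * δ / s + 1) * s := by field_simp
    rw [h1, h2]
    nlinarith
  · intro v hv
    have hsub : (Finset.Icc ⌈(-Δ - φ v) / s⌉ ⌊(Δ - φ v) / s⌋).image (fun t : ℤ => v + t • b) ⊆
        Finset.bipartiteAbove (fun v v' : G => ∃ t : ℤ, v' = v + t • b) S' v := by
      intro x hx
      obtain ⟨t, ht, rfl⟩ := Finset.mem_image.1 hx
      rw [Finset.mem_Icc, Int.ceil_le, Int.le_floor, div_le_iff₀ hb, le_div_iff₀ hb] at ht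
      refine Finset.mem_filter.2 ⟨hS' v hv t ?_, t, rfl⟩
      rw [hφ, abs_le]
      constructor <;> linarith
    have hcard := Finset.card_le_card hsub
    rw [Finset.card_image_of_injective _ (hinj v), Int.card_Icc] at hcard
    have h3 : ((⌊(Δ - φ v) / s⌋ + 1 - ⌈(-Δ - φ v) / s⌉ : ℤ) : ℝ) ≤
        ((Finset.bipartiteAbove (fun v v' : G => ∃ t : ℤ, v' = v + t • b) S' v).card : ℝ) := by
      have := (Int.self_le_toNat _).trans (Int.ofNat_le.2 hcard)
      exact_mod_cast this
    have h4 := Int.sub_one_lt_floor ((Δ - φ v) / s)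
    have h5 := Int.ceil_lt_add_one ((-Δ - φ v) / s)
    have h6 : 2 * Δ / s = (Δ - φ v) / s - (-Δ - φ v) / s := by field_simp; ring
    push_cast at h3
    linarith
  · intro v' hv'
    have hsub : Finset.bipartiteBelow (fun v v' : G => ∃ t : ℤ, v' = v + t • b) S v' ⊆
        (Finset.Icc ⌈(-δ - φ v') / s⌉ ⌊(δ - φ v') / s⌋).image (fun t : ℤ => v' + t • b) := by
      intro x hx
      obtain ⟨hxS, t, ht⟩ := Finset.mem_filter.1 hx
      have hx' : x = v' + (-t) • b := by rw [ht]; simp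
      refine Finset.mem_image.2 ⟨-t, ?_, hx'.symm⟩
      have h7 := abs_le.1 (hS x hxS)
      rw [hx', hφ] at h7
      rw [Finset.mem_Icc, Int.ceil_le, Int.le_floor, div_le_iff₀ hb, le_div_iff₀ hb]
      constructor <;> linarith
    have hcard := Finset.card_le_card hsub
    rw [Finset.card_image_of_injective _ (hinj v'), Int.card_Icc] at hcard
    have h4 := Int.floor_le ((δ - φ v') / s)
    have h5 := Int.le_ceil ((-δ - φ v') / s)
    have h6 : 2 * δ / s = (δ - φ v') / s - (-δ - φ v') / s := by field_simp; ring
    have h8 : 0 ≤ 2 * δ / s := by positivity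
    have h9 : ((⌊(δ - φ v') / s⌋ + 1 - ⌈(-δ - φ v') / s⌉).toNat : ℝ) ≤ 2 * δ / s + 1 := by
      rcases le_total 0 (⌊(δ - φ v') / s⌋ + 1 - ⌈(-δ - φ v') / s⌉) with h | h
      · have : ((⌊(δ - φ v') / s⌋ + 1 - ⌈(-δ - φ v') / s⌉).toNat : ℝ) =
          ((⌊(δ - φ v') / s⌋ + 1 - ⌈(-δ - φ v') / s⌉ : ℤ) : ℝ) := by
          exact_mod_cast Int.toNat_of_nonneg h
        rw [this]; push_cast; linarith
      · rw [Int.toNat_of_nonpos h]; push_cast; linarith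
    exact le_trans (by exact_mod_cast hcard) h9

/-- Minkowski's inequality for sums of squares. -/
theorem sum_add_sq_le {ι : Type*} [Fintype ι] {v w : ι → ℝ} {r s : ℝ} (hr : 0 ≤ r) (hs : 0 ≤ s)
    (hv : ∑ i, v i ^ 2 ≤ r ^ 2) (hw : ∑ i, w i ^ 2 ≤ s ^ 2) :
    ∑ i, (v i + w i) ^ 2 ≤ (r + s) ^ 2 := by
  have h1 := Finset.sum_mul_sq_le_sq_mul_sq Finset.univ v w
  have h2 : (∑ i, v i * w i) ≤ r * s := by
    refine (le_abs_self _).trans (abs_le_of_sq_le_sq (h1.trans ?_) (by positivity))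
    rw [mul_pow]
    exact mul_le_mul hv hw (Finset.sum_nonneg fun i _ => sq_nonneg _) (sq_nonneg _)
  have h3 : ∑ i, (v i + w i) ^ 2 = ∑ i, v i ^ 2 + 2 * ∑ i, v i * w i + ∑ i, w i ^ 2 := by
    rw [Finset.mul_sum, ← Finset.sum_add_distrib, ← Finset.sum_add_distrib]
    exact Finset.sum_congr rfl fun i _ => by ring
  rw [h3]
  nlinarith

/-- The integer vectors of bounded sum of squares form a finite set. -/
theorem finite_int_sum_sq_le (ι : Type*) [Fintype ι] (R : ℝ) :
    {v : ι → ℤ | ∑ i, (v i : ℝ) ^ 2 ≤ R}.Finite := by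
  classical
  refine Set.Finite.subset (Fintype.piFinset fun _ : ι => Finset.Icc (-⌈R⌉) ⌈R⌉).finite_toSet ?_
  intro v hv
  simp only [Finset.mem_coe, Fintype.mem_piFinset, Finset.mem_Icc]
  intro i
  have h1 : (v i : ℝ) ^ 2 ≤ R :=
    (Finset.single_le_sum (f := fun i => (v i : ℝ) ^ 2) (fun i _ => sq_nonneg _)
      (Finset.mem_univ i)).trans hv
  have h2 : (v i) ^ 2 ≤ ⌈R⌉ := by
    have := h1.trans (Int.le_ceil R)
    exact_mod_cast this
  have h3 : |v i| ≤ (v i) ^ 2 := by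
    rw [← sq_abs]
    rcases (abs_nonneg (v i)).eq_or_lt with h | h
    · rw [← h]; norm_num
    · nlinarith
  exact abs_le.1 (h3.trans h2)

/-- The integer vectors whose sum of squares is at most `R`. -/
def ballZ (ι : Type*) [Fintype ι] (R : ℝ) : Finset (ι → ℤ) :=
  (finite_int_sum_sq_le ι R).toFinset

@[simp]
theorem mem_ballZ {ι : Type*} [Fintype ι] {R : ℝ} {v : ι → ℤ} :
    v ∈ ballZ ι R ↔ ∑ i, (v i : ℝ) ^ 2 ≤ R := by
  simp [ballZ]

/-- The linear form `v ↦ ⟨u, v⟩` on integer vectors. -/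
def pairing {ι : Type*} [Fintype ι] (u : ι → ℝ) : (ι → ℤ) →+ ℝ where
  toFun v := ∑ i, u i * (v i : ℝ)
  map_zero' := by simp
  map_add' v w := by simp [mul_add, Finset.sum_add_distrib]

theorem pairing_apply {ι : Type*} [Fintype ι] (u : ι → ℝ) (v : ι → ℤ) :
    pairing u v = ∑ i, u i * (v i : ℝ) := rfl

open scoped Classical in
/-- The integer vectors in the slab `|⟨u, v⟩| ≤ δ` whose sum of squares is at most `R`. -/
def slabZ {ι : Type*} [Fintype ι] (u : ι → ℝ) (δ R : ℝ) : Finset (ι → ℤ) :=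
  (ballZ ι R).filter fun v => |pairing u v| ≤ δ

theorem mem_slabZ {ι : Type*} [Fintype ι] {u : ι → ℝ} {δ R : ℝ} {v : ι → ℤ} :
    v ∈ slabZ u δ R ↔ ∑ i, (v i : ℝ) ^ 2 ≤ R ∧ |pairing u v| ≤ δ := by
  simp [slabZ]

theorem sum_sq_le_sum_abs_sq {ι : Type*} [Fintype ι] (v : ι → ℝ) :
    ∑ i, v i ^ 2 ≤ (∑ i, |v i|) ^ 2 := by
  have := Finset.sum_sq_le_sq_sum_of_nonneg (s := Finset.univ) (f := fun i => |v i|)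
    fun i _ => abs_nonneg _
  simpa [sq_abs] using this

/-- Widening of a slab by means of an integer vector `b` that is short compared with its height. -/
theorem card_slab_widen {ι : Type*} [Fintype ι] (u : ι → ℝ) (b : ι → ℤ) {δ Δ r e H : ℝ}
    (hδ : 0 < δ) (hΔ : δ ≤ Δ) (hr : 0 ≤ r) (he : 0 ≤ e) (hH : 0 ≤ H)
    (hb : pairing u b ≠ 0) (hbe : |pairing u b| ≤ e * δ)
    (hbH : 2 * Δ * ∑ i, |(b i : ℝ)| ≤ e * H * |pairing u b|) :
    (2 - e) * Δ * ((slabZ u δ (r ^ 2)).card : ℝ) ≤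
      (2 + e) * δ * ((slabZ u Δ ((r + e * H) ^ 2)).card : ℝ) := by
  wlog hpos : 0 < pairing u b generalizing b
  · refine this (-b) (by simpa using hb) (by simpa using hbe) (by simpa using hbH) ?_
    rw [map_neg]
    exact neg_pos.2 (lt_of_le_of_ne (not_lt.1 hpos) hb)
  rw [abs_of_pos hpos] at hbe hbH
  have key := card_window_le (pairing u) b hpos hδ.le (Δ := Δ) (slabZ u δ (r ^ 2))
    (slabZ u Δ ((r + e * H) ^ 2)) (fun v hv => (mem_slabZ.1 hv).2) ?_
  · have h1 : (0 : ℝ) ≤ (slabZ u δ (r ^ 2)).card := Nat.cast_nonneg _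
    have h2 : (0 : ℝ) ≤ (slabZ u Δ ((r + e * H) ^ 2)).card := Nat.cast_nonneg _
    have h3 : e * δ ≤ e * Δ := mul_le_mul_of_nonneg_left hΔ he
    calc _ ≤ (2 * Δ - pairing u b) * ((slabZ u δ (r ^ 2)).card : ℝ) :=
          mul_le_mul_of_nonneg_right (by linarith) h1
      _ ≤ _ := key
      _ ≤ _ := mul_le_mul_of_nonneg_right (by linarith) h2
  · intro v hv t ht
    obtain ⟨hv1, hv2⟩ := mem_slabZ.1 hv
    refine mem_slabZ.2 ⟨?_, ht⟩
    have h4 : |(t : ℝ)| * pairing u b ≤ 2 * Δ := by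
      have : pairing u (v + t • b) = pairing u v + t * pairing u b := by
        rw [map_add, map_zsmul, zsmul_eq_mul]
      rw [this] at ht
      rw [← abs_of_pos hpos, ← abs_mul]
      have := abs_sub_abs_le_abs_sub ((t : ℝ) * pairing u b) (-pairing u v)
      rw [abs_neg, sub_neg_eq_add, add_comm _ (pairing u v)] at this
      linarith
    have h5 : |(t : ℝ)| * ∑ i, |(b i : ℝ)| ≤ e * H := by
      have h6 : 0 ≤ ∑ i, |(b i : ℝ)| := Finset.sum_nonneg fun i _ => abs_nonneg _
      have h7 := mul_le_mul_of_nonneg_right h4 h6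
      have h8 : |(t : ℝ)| * (∑ i, |(b i : ℝ)|) * pairing u b ≤ e * H * pairing u b := by linarith
      exact le_of_mul_le_mul_right h8 hpos
    have h9 := sum_add_sq_le (v := fun i => (v i : ℝ)) (w := fun i => (t : ℝ) * b i) hr
      (mul_nonneg he hH) hv1 ?_
    · simpa using h9
    · refine (sum_sq_le_sum_abs_sq _).trans ?_
      simp only [abs_mul, ← Finset.mul_sum]
      exact pow_le_pow_left₀ (by positivity) h5 2

/-- Pythagoras for the component of `w` orthogonal to the unit vector `u`. -/
theorem sum_sub_proj_sq {ι : Type*} [Fintype ι] {u : ι → ℝ} (hu : ∑ i, u i ^ 2 = 1) (w : ι → ℝ) :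
    ∑ i, (w i - (∑ k, u k * w k) * u i) ^ 2 = ∑ i, w i ^ 2 - (∑ k, u k * w k) ^ 2 := by
  have h1 : ∀ p : ℝ, ∑ i, (w i - p * u i) ^ 2 =
      ∑ i, w i ^ 2 - 2 * p * ∑ i, u i * w i + p ^ 2 * ∑ i, u i ^ 2 := by
    intro p
    rw [Finset.mul_sum, Finset.mul_sum, ← Finset.sum_sub_distrib, ← Finset.sum_add_distrib]
    exact Finset.sum_congr rfl fun i _ => by ring
  rw [h1, hu]
  ring

/-- A slab that is not too thin occupies the expected proportion of a slightly larger ball. -/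
theorem card_slab_le_card_ball {n : ℕ} (hn : 1 ≤ n) {u : Fin n → ℝ} (hu : ∑ i, u i ^ 2 = 1)
    {δ H r e : ℝ} (he : e = 1 / (n : ℝ) ^ 12) (hδ : 4 * (n : ℝ) ^ 24 ≤ δ)
    (hδH : δ ≤ H / n) (hr : 0 ≤ r) :
    (2 - e) * (H / n) * ((slabZ u δ (r ^ 2)).card : ℝ) ≤
      (2 + e) * δ * ((ballZ (Fin n) ((H / n) ^ 2 + (r + e * H) ^ 2)).card : ℝ) := by
  have hn1 : (1 : ℝ) ≤ n := by exact_mod_cast hn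
  have hn0 : (0 : ℝ) < n := by linarith
  have hn12 : (n : ℝ) ≤ (n : ℝ) ^ 12 := le_self_pow₀ hn1 (by norm_num)
  have he0 : 0 < e := by rw [he]; positivity
  have hen : e * (n : ℝ) ^ 12 = 1 := by rw [he]; field_simp
  have hδ0 : 0 < δ := lt_of_lt_of_le (by positivity) hδ
  set lam : ℝ := 3 * (n : ℝ) ^ 12 with hlam
  set b : Fin n → ℤ := fun i => round (lam * u i) with hb
  set f : Fin n → ℝ := fun i => b i - lam * u i with hf
  have hf1 : ∀ i, |f i| ≤ 1 := fun i => by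
    have := abs_sub_round (lam * u i)
    rw [abs_sub_comm] at this
    simp only [hf, hb]
    linarith
  have hf2 : ∑ i, f i ^ 2 ≤ (n : ℝ) ^ 2 := by
    calc ∑ i, f i ^ 2 ≤ ∑ _i : Fin n, (1 : ℝ) :=
          Finset.sum_le_sum fun i _ => (sq_le_one_iff_abs_le_one _).2 (hf1 i)
      _ = n := by simp
      _ ≤ (n : ℝ) ^ 2 := by nlinarith
  have huf : |∑ i, u i * f i| ≤ n := by
    have := Finset.sum_mul_sq_le_sq_mul_sq Finset.univ u f
    rw [hu, one_mul] at this
    exact abs_le_of_sq_le_sq (this.trans hf2) hn0.le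
  have hbf : ∀ i, (b i : ℝ) = lam * u i + f i := fun i => by simp [hf]
  have hub : pairing u b = lam + ∑ i, u i * f i := by
    rw [pairing_apply]
    simp only [hbf, mul_add, Finset.sum_add_distrib]
    congr 1
    calc ∑ i, u i * (lam * u i) = lam * ∑ i, u i ^ 2 := by
          rw [Finset.mul_sum]
          exact Finset.sum_congr rfl fun i _ => by ring
      _ = lam := by rw [hu, mul_one]
  have hs1 : 2 * (n : ℝ) ^ 12 ≤ pairing u b := by
    rw [hub]; linarith [(abs_le.1 huf).1]
  have hs2 : pairing u b ≤ 4 * (n : ℝ) ^ 12 := by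
    rw [hub]; linarith [(abs_le.1 huf).2]
  have hs0 : 0 < pairing u b := lt_of_lt_of_le (by positivity) hs1
  have hse : pairing u b ≤ e * δ := by
    have h1 : e * (4 * (n : ℝ) ^ 24) = 4 * (n : ℝ) ^ 12 := by
      rw [show (n : ℝ) ^ 24 = (n : ℝ) ^ 12 * (n : ℝ) ^ 12 by ring]
      linear_combination 4 * (n : ℝ) ^ 12 * hen
    linarith [mul_le_mul_of_nonneg_left hδ he0.le]
  have key := card_window_le (pairing u) b hs0 hδ0.le (Δ := H / n) (slabZ u δ (r ^ 2))
    (ballZ (Fin n) ((H / n) ^ 2 + (r + e * H) ^ 2)) (fun v hv => (mem_slabZ.1 hv).2) ?_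
  · have h1 : (0 : ℝ) ≤ (slabZ u δ (r ^ 2)).card := Nat.cast_nonneg _
    have h2 : (0 : ℝ) ≤ (ballZ (Fin n) ((H / n) ^ 2 + (r + e * H) ^ 2)).card := Nat.cast_nonneg _
    have h3 : e * δ ≤ e * (H / n) := mul_le_mul_of_nonneg_left hδH he0.le
    calc _ ≤ (2 * (H / n) - pairing u b) * ((slabZ u δ (r ^ 2)).card : ℝ) :=
          mul_le_mul_of_nonneg_right (by linarith) h1
      _ ≤ _ := key
      _ ≤ _ := mul_le_mul_of_nonneg_right (by linarith) h2
  · intro v hv t ht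
    obtain ⟨hv1, hv2⟩ := mem_slabZ.1 hv
    rw [mem_ballZ]
    have hadd : pairing u (v + t • b) = pairing u v + t * pairing u b := by
      rw [map_add, map_zsmul, zsmul_eq_mul]
    have h4 : |(t : ℝ)| * pairing u b ≤ 2 * (H / n) := by
      rw [hadd] at ht
      rw [← abs_of_pos hs0, ← abs_mul]
      have := abs_sub_abs_le_abs_sub ((t : ℝ) * pairing u b) (-pairing u v)
      rw [abs_neg, sub_neg_eq_add, add_comm _ (pairing u v)] at this
      linarith
    have h5 : |(t : ℝ)| * n ≤ e * H := by
      have h6 : |(t : ℝ)| * (2 * (n : ℝ) ^ 12) ≤ 2 * (H / n) :=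
        (mul_le_mul_of_nonneg_left hs1 (abs_nonneg _)).trans h4
      have h7 : |(t : ℝ)| * (n : ℝ) ^ 12 * n ≤ H := by
        rw [← le_div_iff₀ hn0]; linarith
      have h8 := mul_le_mul_of_nonneg_left h7 he0.le
      calc |(t : ℝ)| * n = e * (|(t : ℝ)| * (n : ℝ) ^ 12 * n) := by
            linear_combination -(|(t : ℝ)| * n) * hen
        _ ≤ e * H := h8
    set w : Fin n → ℝ := fun i => ((v + t • b) i : ℤ) with hw
    have hpw : ∑ k, u k * w k = pairing u (v + t • b) := rfl
    have hwi : ∀ i, w i - (∑ k, u k * w k) * u i =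
        ((v i : ℝ) - (∑ k, u k * (v k : ℝ)) * u i) +
          t * (f i - (∑ k, u k * f k) * u i) := by
      intro i
      have h9 : w i = v i + t * (lam * u i + f i) := by
        rw [← hbf]; simp [hw]
      have h10 : ∑ k, u k * (v k : ℝ) = pairing u v := rfl
      rw [hpw, hadd, hub, h9, h10]
      ring
    have h11 := sum_sub_proj_sq hu w
    have h12 := sum_sub_proj_sq hu (fun i => (v i : ℝ))
    have h13 := sum_sub_proj_sq hu f
    have h14 : ∑ i, (w i - (∑ k, u k * w k) * u i) ^ 2 ≤ (r + e * H) ^ 2 := by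
      simp only [hwi]
      refine sum_add_sq_le hr ((mul_nonneg (abs_nonneg _) hn0.le).trans h5) ?_ ?_
      · rw [h12]; linarith [sq_nonneg (∑ k, u k * (v k : ℝ))]
      · have h15 : ∑ i, (t * (f i - (∑ k, u k * f k) * u i)) ^ 2 ≤ (|(t : ℝ)| * n) ^ 2 := by
          simp only [mul_pow, ← Finset.mul_sum, h13, sq_abs]
          exact mul_le_mul_of_nonneg_left (by linarith [sq_nonneg (∑ k, u k * f k)]) (sq_nonneg _)
        exact h15.trans (pow_le_pow_left₀ (by positivity) h5 2)
    have h16 : (∑ k, u k * w k) ^ 2 ≤ (H / n) ^ 2 := by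
      rw [hpw]; exact sq_le_sq' (abs_le.1 ht).1 (abs_le.1 ht).2
    have h17 : ∑ i, w i ^ 2 = ∑ i, (((v + t • b) i : ℤ) : ℝ) ^ 2 := rfl
    linarith

/-- A rational vector with a coordinate equal to `1` is proportional to a unimodular vector. -/
theorem exists_unimodular_proportional {ι : Type*} [Fintype ι] [DecidableEq ι] (r : ι → ℚ) (i₀ : ι)
    (hr : r i₀ = 1) :
    ∃ y b : ι → ℤ, ∑ i, b i * y i = 1 ∧ 0 < y i₀ ∧ ∀ i, (y i : ℚ) = y i₀ * r i := by
  set D : ℤ := ∏ k, ((r k).den : ℤ) with hD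
  set y₀ : ι → ℤ := fun i => (r i).num * ∏ k ∈ Finset.univ.erase i, ((r k).den : ℤ) with hy₀
  have hDpos : 0 < D := Finset.prod_pos fun k _ => by exact_mod_cast (r k).den_pos
  have hy₀r : ∀ i, (y₀ i : ℚ) = D * r i := by
    intro i
    have h1 : D = ((r i).den : ℤ) * ∏ k ∈ Finset.univ.erase i, ((r k).den : ℤ) :=
      (Finset.mul_prod_erase _ _ (Finset.mem_univ i)).symm
    rw [h1]
    have h2 : ((r i).den : ℚ) * r i = (r i).num := by
      rw [mul_comm]; exact Rat.mul_den_eq_num _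
    push_cast [hy₀]
    linear_combination (-∏ k ∈ Finset.univ.erase i, ((r k).den : ℚ)) * h2
  have hy₀0 : y₀ i₀ = D := by
    have := hy₀r i₀
    rw [hr, mul_one] at this
    exact_mod_cast this
  obtain ⟨g, hg⟩ := (IsPrincipalIdealRing.principal (Ideal.span (Set.range y₀))).principal
  have hdvd : ∀ i, ∃ c, y₀ i = g * c := fun i => by
    have : y₀ i ∈ Ideal.span {g} := by
      rw [Ideal.span, ← hg]; exact Ideal.subset_span ⟨i, rfl⟩
    exact Ideal.mem_span_singleton.1 this
  have hgmem : g ∈ Ideal.span (Set.range y₀) := by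
    rw [hg]; exact Submodule.mem_span_singleton_self g
  obtain ⟨c, hc⟩ := Ideal.mem_span_range_iff_exists_fun.1 hgmem
  choose x hx using hdvd
  have hg0 : g ≠ 0 := by
    rintro rfl
    have := hx i₀
    rw [hy₀0] at this
    omega
  have hcx : ∑ i, c i * x i = 1 := by
    have : g * ∑ i, c i * x i = g * 1 := by
      rw [mul_one, Finset.mul_sum, ← hc]
      refine Finset.sum_congr rfl fun i _ => ?_
      rw [hc, hx i]; ring
    exact mul_left_cancel₀ hg0 this
  have hxr : ∀ i, (x i : ℚ) = x i₀ * r i := by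
    intro i
    have h1 := hy₀r i
    rw [← hy₀0, hx i, hx i₀] at h1
    push_cast at h1
    have hgq : (g : ℚ) ≠ 0 := by exact_mod_cast hg0
    exact mul_left_cancel₀ hgq (by linear_combination h1)
  have hx0 : x i₀ ≠ 0 := by
    intro h
    have := hx i₀
    rw [hy₀0, h] at this
    omega
  rcases lt_or_gt_of_ne hx0 with h | h
  · refine ⟨-x, -c, by simpa using hcx, by simpa using h, fun i => ?_⟩
    simp [hxr i]
  · exact ⟨x, c, hcx, h, hxr⟩

theorem pairing_single {ι : Type*} [Fintype ι] [DecidableEq ι] (u : ι → ℝ) (i : ι) (a : ℤ) :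
    pairing u (Pi.single i a) = u i * a := by
  rw [pairing_apply, Finset.sum_eq_single i]
  · simp
  · intro k _ hk; simp [Pi.single_eq_of_ne hk]
  · simp

/-- A unit vector has a coordinate of maximal size, which is at least `1 / n`. -/
theorem exists_large_coord {n : ℕ} {u : Fin n → ℝ} (hu : ∑ i, u i ^ 2 = 1) :
    ∃ i₀, (∀ i, |u i| ≤ |u i₀|) ∧ 1 ≤ n * |u i₀| := by
  have hne : Nonempty (Fin n) := by
    by_contra h
    rw [not_nonempty_iff] at h
    simp at hu
  obtain ⟨i₀, hi₀⟩ := Finite.exists_max fun i => |u i|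
  refine ⟨i₀, hi₀, ?_⟩
  have h1 : |u i₀| ^ 2 ≤ 1 := by
    rw [sq_abs, ← hu]
    exact Finset.single_le_sum (f := fun i => u i ^ 2) (fun i _ => sq_nonneg _) (Finset.mem_univ _)
  have h2 : |u i₀| ≤ 1 := abs_le_of_sq_le_sq (by simpa using h1) zero_le_one |>.trans' (by simp)
  calc (1 : ℝ) = ∑ i, u i ^ 2 := hu.symm
    _ ≤ ∑ _i : Fin n, |u i₀| := Finset.sum_le_sum fun i _ => by
        rw [← sq_abs]
        nlinarith [hi₀ i, abs_nonneg (u i)]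
    _ = n * |u i₀| := by simp

/-- Either some integer vector has a small but not too small height over `u`, or `u` is very close
to the direction of a short unimodular vector. -/
theorem exists_height_or_unimodular {n : ℕ} {u : Fin n → ℝ} (hu : ∑ i, u i ^ 2 = 1) {Q : ℕ}
    (hQ : 1 ≤ Q) {τ : ℝ} (hτ : 0 ≤ τ) (hQτ : 16 * (n : ℝ) ^ 2 * (Q : ℝ) ^ 2 * τ ≤ 1) :
    (∃ b : Fin n → ℤ, pairing u b ≠ 0 ∧ |pairing u b| ≤ 2 / Q ∧
      (∑ i, |(b i : ℝ)|) * τ ≤ |pairing u b|) ∨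
    (∃ y b : Fin n → ℤ, ∑ i, b i * y i = 1 ∧ (∀ i, |(y i : ℝ)| ≤ 2 * Q) ∧
      ∃ lam : ℝ, |lam| ≤ n * Q ∧ ∀ i, |(y i : ℝ) - lam * u i| ≤ 3 * n * Q * τ) := by
  by_cases hfirst : ∃ b : Fin n → ℤ, pairing u b ≠ 0 ∧ |pairing u b| ≤ 2 / Q ∧
      (∑ i, |(b i : ℝ)|) * τ ≤ |pairing u b|
  · exact Or.inl hfirst
  refine Or.inr ?_
  push Not at hfirst
  have hQ1 : (1 : ℝ) ≤ Q := by exact_mod_cast hQ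
  obtain ⟨i₀, hmax, hlarge⟩ := exists_large_coord hu
  have hn : 1 ≤ n := Nat.one_le_iff_ne_zero.2 fun h => by subst h; exact i₀.elim0
  have hn1 : (1 : ℝ) ≤ n := by exact_mod_cast hn
  have hu0 : 0 < |u i₀| := by
    by_contra h
    have : |u i₀| = 0 := le_antisymm (not_lt.1 h) (abs_nonneg _)
    rw [this] at hlarge; norm_num at hlarge
  have hu0' : u i₀ ≠ 0 := abs_pos.1 hu0
  have hu1 : |u i₀| ≤ 1 := by
    have h1 : u i₀ ^ 2 ≤ 1 := by
      rw [← hu]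
      exact Finset.single_le_sum (f := fun i => u i ^ 2) (fun i _ => sq_nonneg _)
        (Finset.mem_univ _)
    exact (sq_le_one_iff_abs_le_one _).1 h1
  set α : Fin n → ℝ := fun i => u i / u i₀ with hα
  have hαu : ∀ i, u i = u i₀ * α i := fun i => by simp only [hα]; field_simp
  have hα1 : ∀ i, |α i| ≤ 1 := fun i => by
    simp only [hα, abs_div]
    exact (div_le_one hu0).2 (hmax i)
  have hex : ∀ i, ∃ q : ℚ, |α i - q| ≤ 1 / (((Q : ℝ) + 1) * q.den) ∧ q.den ≤ Q ∧
      (i = i₀ → q = 1) := by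
    intro i
    by_cases hi : i = i₀
    · refine ⟨1, ?_, by simpa using hQ, fun _ => rfl⟩
      have : α i = 1 := by rw [hi]; simp [hα, hu0']
      rw [this]
      simp
      positivity
    · obtain ⟨q, h1, h2⟩ := Real.exists_rat_abs_sub_le_and_den_le (α i) hQ
      exact ⟨q, h1, h2, fun h => absurd h hi⟩
  choose r hr1 hr2 hr3 using hex
  have hri : r i₀ = 1 := hr3 i₀ rfl
  have hden : ∀ i, (1 : ℝ) ≤ (r i).den := fun i => by exact_mod_cast (r i).den_pos
  have hr4 : ∀ i, |α i - r i| ≤ 1 := fun i => by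
    refine (hr1 i).trans ?_
    rw [div_le_one (by have := hden i; positivity)]
    nlinarith [hden i]
  have hr5 : ∀ i, |(r i : ℝ)| ≤ 2 := fun i => by
    have := abs_sub_abs_le_abs_sub (r i : ℝ) (α i)
    rw [abs_sub_comm] at this
    linarith [hr4 i, hα1 i]
  have hnum : ∀ i, ((r i).num : ℝ) = (r i).den * (r i : ℝ) := fun i => by
    have : ((r i).num : ℚ) = (r i).den * r i := by rw [mul_comm]; exact (Rat.mul_den_eq_num _).symm
    exact_mod_cast this
  have hκ : ∀ i, |α i - r i| ≤ 3 * n * τ := by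
    intro i
    set b : Fin n → ℤ := Pi.single i ((r i).den : ℤ) - Pi.single i₀ (r i).num with hb
    have hpb : pairing u b = u i₀ * (r i).den * (α i - r i) := by
      rw [hb, map_sub, pairing_single, pairing_single, hnum, hαu i]
      push_cast
      ring
    have hd := hden i
    have habs : |pairing u b| = |u i₀| * (r i).den * |α i - r i| := by
      rw [hpb, abs_mul, abs_mul, abs_of_pos (by linarith : (0 : ℝ) < (r i).den)]
    by_cases h0 : pairing u b = 0
    · rw [h0, abs_zero] at habs
      have : |α i - r i| = 0 := by
        rcases mul_eq_zero.1 habs.symm with h | h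
        · have : 0 < |u i₀| * (r i).den := by positivity
          linarith
        · exact h
      rw [this]; positivity
    have hle : |pairing u b| ≤ 2 / Q := by
      rw [habs]
      have h1 := hr1 i
      rw [le_div_iff₀ (by positivity)] at h1 ⊢
      have h2 : 0 ≤ (r i).den * |α i - r i| := by positivity
      have h3 : |u i₀| * ((r i).den * |α i - r i|) ≤ 1 * ((r i).den * |α i - r i|) :=
        mul_le_mul_of_nonneg_right hu1 h2
      nlinarith
    have hsum : ∑ k, |(b k : ℝ)| ≤ 3 * (r i).den := by
      calc ∑ k, |(b k : ℝ)| ≤ ∑ k, (((Pi.single i ((r i).den : ℝ) : Fin n → ℝ) k) +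
            ((Pi.single i₀ |((r i).num : ℝ)| : Fin n → ℝ) k)) := by
            refine Finset.sum_le_sum fun k _ => ?_
            simp only [hb, Pi.sub_apply, Int.cast_sub]
            refine (abs_sub _ _).trans (add_le_add (le_of_eq ?_) (le_of_eq ?_))
            · by_cases hk : k = i
              · subst hk; simp
              · simp [Pi.single_eq_of_ne hk]
            · by_cases hk : k = i₀
              · subst hk; simp
              · simp [Pi.single_eq_of_ne hk]
        _ = (r i).den + |((r i).num : ℝ)| := by
            rw [Finset.sum_add_distrib, Finset.sum_pi_single', Finset.sum_pi_single']
            simp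
        _ ≤ 3 * (r i).den := by
            rw [hnum, abs_mul, abs_of_pos (by linarith : (0 : ℝ) < (r i).den)]
            nlinarith [hr5 i]
    have h1 := hfirst b h0 hle
    rw [habs] at h1
    have h2 : |u i₀| * (r i).den * |α i - r i| ≤ 3 * (r i).den * τ :=
      h1.le.trans (mul_le_mul_of_nonneg_right hsum hτ)
    have h3 : |u i₀| * |α i - r i| ≤ 3 * τ := by
      refine le_of_mul_le_mul_right ?_ (by linarith : (0 : ℝ) < (r i).den)
      linarith
    calc |α i - r i| ≤ n * |u i₀| * |α i - r i| := le_mul_of_one_le_left (abs_nonneg _) hlarge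
      _ ≤ 3 * n * τ := by nlinarith
  obtain ⟨y, c, hcy, hy0, hyr⟩ := exists_unimodular_proportional r i₀ hri
  have hyr' : ∀ i, (y i : ℝ) = y i₀ * (r i : ℝ) := fun i => by exact_mod_cast hyr i
  have hy0' : (0 : ℝ) < y i₀ := by exact_mod_cast hy0
  have hcr : (y i₀ : ℝ) * ∑ i, c i * (r i : ℝ) = 1 := by
    have : (1 : ℝ) = ∑ i, (c i : ℝ) * y i := by exact_mod_cast hcy.symm
    rw [this, Finset.mul_sum]
    exact Finset.sum_congr rfl fun i _ => by rw [hyr' i]; ring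
  rcases le_or_gt (y i₀) Q with hyQ | hyQ
  · have hyQ' : (y i₀ : ℝ) ≤ Q := by exact_mod_cast hyQ
    refine ⟨y, c, hcy, fun i => ?_, y i₀ / u i₀, ?_, fun i => ?_⟩
    · rw [hyr' i, abs_mul, abs_of_pos hy0']
      nlinarith [hr5 i, abs_nonneg (r i : ℝ)]
    · rw [abs_div, abs_of_pos hy0', div_le_iff₀ hu0]
      nlinarith
    · have : (y i : ℝ) - y i₀ / u i₀ * u i = -(y i₀ * (α i - r i)) := by
        rw [hyr' i]; simp only [hα]; ring
      rw [this, abs_neg, abs_mul, abs_of_pos hy0']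
      calc (y i₀ : ℝ) * |α i - r i| ≤ Q * (3 * n * τ) :=
            mul_le_mul hyQ' (hκ i) (abs_nonneg _) (by positivity)
        _ = 3 * n * Q * τ := by ring
  · exfalso
    set z : ℤ := y i₀ / Q with hz
    have hQz : (0 : ℤ) < Q := by exact_mod_cast hQ
    have hz1 : 1 ≤ z := by
      rw [hz, Int.le_ediv_iff_mul_le hQz]; linarith
    have hz2 : z * Q ≤ y i₀ := Int.ediv_mul_le _ hQz.ne'
    have hz3 : y i₀ < (z + 1) * Q := Int.lt_ediv_add_one_mul_self _ hQz
    have hz1' : (1 : ℝ) ≤ z := by exact_mod_cast hz1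
    have hz2' : (z : ℝ) * Q ≤ y i₀ := by exact_mod_cast hz2
    have hz3' : (y i₀ : ℝ) < (z + 1) * Q := by exact_mod_cast hz3
    set m : Fin n → ℤ := fun k => (z * c k) % ((r k).den : ℤ) with hm
    set S : ℤ := ∑ k, (z * c k) / ((r k).den : ℤ) * (r k).num with hS
    set t : Fin n → ℤ := m + Pi.single i₀ S with ht
    have hm0 : ∀ k, (0 : ℝ) ≤ m k := fun k => by
      have : 0 ≤ m k := Int.emod_nonneg _ (by exact_mod_cast (r k).den_ne_zero)
      exact_mod_cast this
    have hmQ : ∀ k, (m k : ℝ) ≤ Q := fun k => by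
      have h1 : m k < ((r k).den : ℤ) := Int.emod_lt_of_pos _ (by exact_mod_cast (r k).den_pos)
      have h2 := hr2 k
      have : m k ≤ Q := by omega
      exact_mod_cast this
    have hmr : ∑ k, (m k : ℝ) * r k + S = z / y i₀ := by
      have h1 : ∀ k, (m k : ℝ) * r k + (((z * c k) / ((r k).den : ℤ) : ℤ) : ℝ) * (r k).num =
          z * (c k * r k) := by
        intro k
        have h2 : m k + ((r k).den : ℤ) * ((z * c k) / ((r k).den : ℤ)) = z * c k :=
          Int.emod_add_mul_ediv _ _
        have h3 : (m k : ℝ) + (r k).den * (((z * c k) / ((r k).den : ℤ) : ℤ) : ℝ) = z * c k := by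
          exact_mod_cast h2
        rw [hnum k]
        linear_combination (r k : ℝ) * h3
      rw [hS]
      push_cast
      rw [← Finset.sum_add_distrib, Finset.sum_congr rfl fun k _ => h1 k, ← Finset.mul_sum]
      rw [eq_div_iff hy0'.ne']
      linear_combination (z : ℝ) * hcr
    have hzy1 : (z : ℝ) / y i₀ ≤ 1 / Q := by
      rw [div_le_div_iff₀ hy0' (by linarith)]; linarith
    have hzy2 : 1 / (2 * (Q : ℝ)) ≤ z / y i₀ := by
      rw [div_le_div_iff₀ (by linarith) hy0']; nlinarith
    have hzy0 : 0 ≤ (z : ℝ) / y i₀ := by positivity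
    have hQinv : 1 / (Q : ℝ) ≤ 1 := by rw [div_le_one (by linarith)]; exact hQ1
    have hSabs : |(S : ℝ)| ≤ 1 + 2 * n * Q := by
      have h1 : |∑ k, (m k : ℝ) * r k| ≤ 2 * n * Q := by
        calc |∑ k, (m k : ℝ) * r k| ≤ ∑ k, |(m k : ℝ) * r k| := Finset.abs_sum_le_sum_abs _ _
          _ ≤ ∑ _k : Fin n, (Q : ℝ) * 2 := Finset.sum_le_sum fun k _ => by
              rw [abs_mul, abs_of_nonneg (hm0 k)]
              exact mul_le_mul (hmQ k) (hr5 k) (abs_nonneg _) (by positivity)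
          _ = 2 * n * Q := by simp; ring
      have h2 : (S : ℝ) = z / y i₀ - ∑ k, (m k : ℝ) * r k := by linarith
      rw [h2]
      refine (abs_sub _ _).trans ?_
      rw [abs_of_nonneg hzy0]
      linarith
    have htsum : ∑ k, |(t k : ℝ)| ≤ 4 * n * Q := by
      calc ∑ k, |(t k : ℝ)| ≤ ∑ k, ((Q : ℝ) + ((Pi.single i₀ |(S : ℝ)| : Fin n → ℝ) k)) := by
            refine Finset.sum_le_sum fun k _ => ?_
            simp only [ht, Pi.add_apply, Int.cast_add]
            refine (abs_add_le _ _).trans (add_le_add ?_ (le_of_eq ?_))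
            · rw [abs_of_nonneg (hm0 k)]; exact hmQ k
            · by_cases hk : k = i₀
              · subst hk; simp
              · simp [Pi.single_eq_of_ne hk]
        _ = n * Q + |(S : ℝ)| := by
            rw [Finset.sum_add_distrib, Finset.sum_pi_single']
            simp
        _ ≤ 4 * n * Q := by nlinarith
    have hpt : pairing u t = u i₀ * (z / y i₀ + ∑ k, m k * (α k - r k)) := by
      rw [ht, map_add, pairing_single, ← hmr, pairing_apply]
      have h1 : ∑ k, u k * (m k : ℝ) = u i₀ * ∑ k, (m k : ℝ) * α k := by
        rw [Finset.mul_sum]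
        exact Finset.sum_congr rfl fun k _ => by rw [hαu k]; ring
      rw [h1]
      simp only [mul_sub, Finset.sum_sub_distrib]
      ring
    have herr : |∑ k, (m k : ℝ) * (α k - r k)| ≤ 1 / (4 * Q) := by
      calc |∑ k, (m k : ℝ) * (α k - r k)| ≤ ∑ k, |(m k : ℝ) * (α k - r k)| :=
            Finset.abs_sum_le_sum_abs _ _
        _ ≤ ∑ _k : Fin n, (Q : ℝ) * (3 * n * τ) := Finset.sum_le_sum fun k _ => by
            rw [abs_mul, abs_of_nonneg (hm0 k)]
            exact mul_le_mul (hmQ k) (hκ k) (abs_nonneg _) (by positivity)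
        _ = 3 * (n : ℝ) ^ 2 * Q * τ := by simp; ring
        _ ≤ 1 / (4 * Q) := by
            rw [le_div_iff₀ (by linarith)]
            have : 0 ≤ (n : ℝ) ^ 2 * (Q : ℝ) ^ 2 * τ := by positivity
            nlinarith
    have hhalf : 1 / (2 * (Q : ℝ)) = 1 / (4 * Q) + 1 / (4 * Q) := by field_simp; norm_num
    have htwo : 2 / (Q : ℝ) = 1 / Q + 4 * (1 / (4 * Q)) := by field_simp; norm_num
    have hquart : 0 < 1 / (4 * (Q : ℝ)) := by positivity
    obtain ⟨herr1, herr2⟩ := abs_le.1 herr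
    have hval : 1 / (4 * (Q : ℝ)) ≤ z / y i₀ + ∑ k, m k * (α k - r k) := by linarith
    have habs : |pairing u t| = |u i₀| * (z / y i₀ + ∑ k, m k * (α k - r k)) := by
      rw [hpt, abs_mul, abs_of_pos (by linarith : 0 < z / (y i₀ : ℝ) + ∑ k, m k * (α k - r k))]
    have hpos : 0 < |pairing u t| := by
      rw [habs]; exact mul_pos hu0 (by linarith)
    have h1 := hfirst t (abs_pos.1 hpos) ?_
    · have h2 : |pairing u t| < 4 * n * Q * τ :=
        h1.trans_le (mul_le_mul_of_nonneg_right htsum hτ)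
      rw [habs] at h2
      have h3 : |u i₀| * (1 / (4 * (Q : ℝ))) < 4 * n * Q * τ :=
        (mul_le_mul_of_nonneg_left hval hu0.le).trans_lt h2
      have h4 : |u i₀| < 16 * n * (Q : ℝ) ^ 2 * τ := by
        have h5 := mul_lt_mul_of_pos_right h3 (by linarith : (0 : ℝ) < 4 * Q)
        have h6 : |u i₀| * (1 / (4 * (Q : ℝ))) * (4 * Q) = |u i₀| := by field_simp
        rw [h6] at h5
        linarith
      have h7 := mul_lt_mul_of_pos_left h4 (by linarith : (0 : ℝ) < n)
      linarith
    · rw [habs]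
      have h2 : z / (y i₀ : ℝ) + ∑ k, m k * (α k - r k) ≤ 2 / Q := by linarith
      calc _ ≤ 1 * (z / (y i₀ : ℝ) + ∑ k, m k * (α k - r k)) :=
            mul_le_mul_of_nonneg_right hu1 (by linarith)
        _ ≤ _ := by linarith

theorem ballZ_mono {ι : Type*} [Fintype ι] {R R' : ℝ} (h : R ≤ R') : ballZ ι R ⊆ ballZ ι R' :=
  fun _ hv => mem_ballZ.2 ((mem_ballZ.1 hv).trans h)

/-- One widening step for a slab: either the slab has at most its expected share of a slab which is
`ρ` times thicker, or all of its points are nearly orthogonal to a small unimodular integer vector. -/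
theorem card_slab_widen_or_unimodular {n : ℕ} (hn : 2 ≤ n) {u : Fin n → ℝ}
    (hu : ∑ i, u i ^ 2 = 1) {δ δ₁ ρ H e : ℝ} (he : e = 1 / (n : ℝ) ^ 12) (hδ : 0 < δ)
    (hδ₁ : δ ≤ δ₁) (hδ₁' : δ₁ ≤ 4 * (n : ℝ) ^ 24) (hρ : 1 ≤ ρ) (hH : 0 < H)
    (hK : 800 * (n : ℝ) ^ 62 * ρ ≤ δ * H) :
    (∃ y b : Fin n → ℤ, ∑ i, b i * y i = 1 ∧ (∀ i, |(y i : ℝ)| ≤ 10 * (n : ℝ) ^ 24 / δ) ∧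
      ∀ x ∈ slabZ u δ (H ^ 2), |((∑ i, x i * y i : ℤ) : ℝ)| ≤ 35 * (n : ℝ) ^ 38 * ρ) ∨
    (∀ r : ℝ, 0 ≤ r → (2 - e) * ρ * ((slabZ u δ₁ (r ^ 2)).card : ℝ) ≤
      (2 + e) * ((slabZ u (ρ * δ₁) ((r + e * H) ^ 2)).card : ℝ)) := by
  have hn2 : (2 : ℝ) ≤ n := by exact_mod_cast hn
  have hn0 : (0 : ℝ) < n := by linarith
  have hn1 : (1 : ℝ) ≤ n := by linarith
  have hδ₁0 : 0 < δ₁ := hδ.trans_le hδ₁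
  have he0 : 0 < e := by rw [he]; positivity
  have hen : e * (n : ℝ) ^ 12 = 1 := by rw [he]; field_simp
  set Q : ℕ := ⌈2 * (n : ℝ) ^ 12 / δ₁⌉₊ with hQdef
  have hQpos : 0 < 2 * (n : ℝ) ^ 12 / δ₁ := by positivity
  have hQ1 : 1 ≤ Q := Nat.one_le_iff_ne_zero.2 (Nat.ceil_pos.2 hQpos).ne'
  have hQ0 : (0 : ℝ) < Q := by exact_mod_cast hQ1
  have hQlow : 2 * (n : ℝ) ^ 12 / δ₁ ≤ Q := Nat.le_ceil _
  have hQup : (Q : ℝ) * δ₁ ≤ 5 * (n : ℝ) ^ 24 := by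
    have h1 : (Q : ℝ) < 2 * (n : ℝ) ^ 12 / δ₁ + 1 := Nat.ceil_lt_add_one hQpos.le
    have h2 : (Q : ℝ) * δ₁ ≤ (2 * (n : ℝ) ^ 12 / δ₁ + 1) * δ₁ :=
      mul_le_mul_of_nonneg_right h1.le hδ₁0.le
    have h3 : (2 * (n : ℝ) ^ 12 / δ₁ + 1) * δ₁ = 2 * (n : ℝ) ^ 12 + δ₁ := by field_simp
    have h4 : 2 * (n : ℝ) ^ 12 ≤ (n : ℝ) ^ 24 := by
      rw [show (n : ℝ) ^ 24 = (n : ℝ) ^ 12 * (n : ℝ) ^ 12 by ring]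
      have : (n : ℝ) ≤ (n : ℝ) ^ 12 := le_self_pow₀ hn1 (by norm_num)
      nlinarith
    linarith
  set τ : ℝ := 2 * (n : ℝ) ^ 12 * (ρ * δ₁) / H with hτdef
  have hτ0 : 0 ≤ τ := by positivity
  have hQτ : (Q : ℝ) * τ * H ≤ 10 * (n : ℝ) ^ 36 * ρ := by
    calc (Q : ℝ) * τ * H = 2 * (n : ℝ) ^ 12 * ρ * (Q * δ₁) := by rw [hτdef]; field_simp
      _ ≤ 2 * (n : ℝ) ^ 12 * ρ * (5 * (n : ℝ) ^ 24) := by gcongr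
      _ = _ := by ring
  have hcond : 16 * (n : ℝ) ^ 2 * (Q : ℝ) ^ 2 * τ ≤ 1 := by
    have h1 : (16 * (n : ℝ) ^ 2 * (Q : ℝ) ^ 2 * τ) * (δ₁ * H) ≤ 800 * (n : ℝ) ^ 62 * ρ := by
      calc (16 * (n : ℝ) ^ 2 * (Q : ℝ) ^ 2 * τ) * (δ₁ * H)
          = 16 * (n : ℝ) ^ 2 * (Q * δ₁) * (Q * τ * H) := by ring
        _ ≤ 16 * (n : ℝ) ^ 2 * (5 * (n : ℝ) ^ 24) * (10 * (n : ℝ) ^ 36 * ρ) := by gcongr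
        _ = _ := by ring
    have h2 : 800 * (n : ℝ) ^ 62 * ρ ≤ δ₁ * H :=
      hK.trans (mul_le_mul_of_nonneg_right hδ₁ hH.le)
    have h3 : 0 < δ₁ * H := by positivity
    by_contra hcon
    push Not at hcon
    nlinarith
  rcases exists_height_or_unimodular hu hQ1 hτ0 hcond with ⟨b, hb0, hb1, hb2⟩ |
    ⟨y, b, hby, hy, lam, hlam, hylam⟩
  · right
    intro r hr
    have h1 : 2 / (Q : ℝ) ≤ e * δ₁ := by
      rw [div_le_iff₀ hQ0]
      have := mul_le_mul_of_nonneg_left hQlow (mul_pos he0 hδ₁0).le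
      have h2 : e * δ₁ * (2 * (n : ℝ) ^ 12 / δ₁) = 2 * (e * (n : ℝ) ^ 12) := by field_simp
      rw [h2, hen] at this
      linarith
    have h3 : 2 * (ρ * δ₁) * ∑ i, |(b i : ℝ)| ≤ e * H * |pairing u b| := by
      have h4 := mul_le_mul_of_nonneg_left hb2 (mul_pos he0 hH).le
      have h5 : e * H * ((∑ i, |(b i : ℝ)|) * τ) =
          (e * (n : ℝ) ^ 12) * (2 * (ρ * δ₁) * ∑ i, |(b i : ℝ)|) := by
        rw [hτdef]; field_simp
      rw [h5, hen, one_mul] at h4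
      exact h4
    have h6 := card_slab_widen u b hδ₁0 (Δ := ρ * δ₁) (by nlinarith) hr he0.le hH.le hb0
      (hb1.trans h1) h3
    have h7 : δ₁ * ((2 - e) * ρ * ((slabZ u δ₁ (r ^ 2)).card : ℝ)) ≤
        δ₁ * ((2 + e) * ((slabZ u (ρ * δ₁) ((r + e * H) ^ 2)).card : ℝ)) := by linarith
    exact le_of_mul_le_mul_left h7 hδ₁0
  · left
    refine ⟨y, b, hby, fun i => (hy i).trans ?_, ?_⟩
    · rw [le_div_iff₀ hδ]
      have : (Q : ℝ) * δ ≤ Q * δ₁ := mul_le_mul_of_nonneg_left hδ₁ hQ0.le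
      linarith
    · intro x hx
      obtain ⟨hx1, hx2⟩ := mem_slabZ.1 hx
      have hxi : ∀ i, |(x i : ℝ)| ≤ H := fun i =>
        abs_le_of_sq_le_sq ((Finset.single_le_sum (f := fun i => (x i : ℝ) ^ 2)
          (fun _ _ => sq_nonneg _) (Finset.mem_univ i)).trans hx1) hH.le
      have hsplit : ((∑ i, x i * y i : ℤ) : ℝ) =
          ∑ i, (x i : ℝ) * ((y i : ℝ) - lam * u i) + lam * pairing u x := by
        rw [pairing_apply, Finset.mul_sum, ← Finset.sum_add_distrib]
        push_cast
        exact Finset.sum_congr rfl fun i _ => by ring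
      have h1 : |∑ i, (x i : ℝ) * ((y i : ℝ) - lam * u i)| ≤ n * (H * (3 * n * Q * τ)) := by
        calc _ ≤ ∑ i, |(x i : ℝ) * ((y i : ℝ) - lam * u i)| := Finset.abs_sum_le_sum_abs _ _
          _ ≤ ∑ _i : Fin n, H * (3 * n * Q * τ) := by
            refine Finset.sum_le_sum fun i _ => ?_
            rw [abs_mul]
            exact mul_le_mul (hxi i) (hylam i) (abs_nonneg _) hH.le
          _ = _ := by simp
      have h2 : |lam * pairing u x| ≤ n * Q * δ := by
        rw [abs_mul]
        exact mul_le_mul hlam hx2 (abs_nonneg _) (by positivity)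
      have h3 : (n : ℝ) * (H * (3 * n * Q * τ)) ≤ 30 * (n : ℝ) ^ 38 * ρ := by
        calc (n : ℝ) * (H * (3 * n * Q * τ)) = 3 * (n : ℝ) ^ 2 * (Q * τ * H) := by ring
          _ ≤ 3 * (n : ℝ) ^ 2 * (10 * (n : ℝ) ^ 36 * ρ) := by gcongr
          _ = _ := by ring
      have h4 : (n : ℝ) * Q * δ ≤ 5 * (n : ℝ) ^ 38 * ρ := by
        calc (n : ℝ) * Q * δ ≤ n * (Q * δ₁) := by
              rw [mul_assoc]; gcongr
          _ ≤ n * (5 * (n : ℝ) ^ 24) := by gcongr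
          _ = 5 * (n : ℝ) ^ 25 * 1 := by ring
          _ ≤ 5 * (n : ℝ) ^ 38 * ρ := by
            gcongr
            norm_num
      rw [hsplit]
      exact (abs_add_le _ _).trans (by linarith)

/-- A slab of half-thickness `δ` has at most its expected share of the points of a slightly larger
ball, unless all of its points are nearly orthogonal to a small unimodular integer vector. -/
theorem card_slab_le_or_unimodular {n : ℕ} (hn : 2 ≤ n) {u : Fin n → ℝ}
    (hu : ∑ i, u i ^ 2 = 1) {δ ρ H e : ℝ} (he : e = 1 / (n : ℝ) ^ 12) (hδ : 0 < δ)
    (hδH : δ ≤ H / n) (hH : 4 * (n : ℝ) ^ 25 ≤ H) (hρ : 0 ≤ ρ)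
    (hρδ : ρ ^ 2 * δ = 4 * (n : ℝ) ^ 24) (hK : 800 * (n : ℝ) ^ 62 * ρ ≤ δ * H) :
    (∃ y b : Fin n → ℤ, ∑ i, b i * y i = 1 ∧ (∀ i, |(y i : ℝ)| ≤ 10 * (n : ℝ) ^ 24 / δ) ∧
      ∀ x ∈ slabZ u δ (H ^ 2), |((∑ i, x i * y i : ℤ) : ℝ)| ≤ 35 * (n : ℝ) ^ 38 * ρ) ∨
    (∀ r : ℝ, 0 ≤ r → r ≤ H → (2 - e) ^ 3 * (H / n) * ((slabZ u δ (r ^ 2)).card : ℝ) ≤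
      (2 + e) ^ 3 * δ *
        ((ballZ (Fin n) (r ^ 2 + H ^ 2 * (1 / (n : ℝ) ^ 2 + 15 * e))).card : ℝ)) := by
  have hn2 : (2 : ℝ) ≤ n := by exact_mod_cast hn
  have hn0 : (0 : ℝ) < n := by linarith
  have hn1 : (1 : ℝ) ≤ n := by linarith
  have he0 : 0 < e := by rw [he]; positivity
  have he1 : e ≤ 1 := by
    rw [he]; exact div_le_one_of_le₀ (one_le_pow₀ hn1) (by positivity)
  have hH0 : 0 < H := lt_of_lt_of_le (by positivity) hH
  have hball : ∀ r s : ℝ, 0 ≤ r → r ≤ H → 0 ≤ s → s ≤ 3 →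
      (((ballZ (Fin n) ((H / n) ^ 2 + (r + s * e * H) ^ 2)).card : ℕ) : ℝ) ≤
        ((ballZ (Fin n) (r ^ 2 + H ^ 2 * (1 / (n : ℝ) ^ 2 + 15 * e))).card : ℝ) := by
    intro r s hr hrH hs hs3
    refine Nat.cast_le.2 (Finset.card_le_card (ballZ_mono ?_))
    have h1 : (r + s * e * H) ^ 2 ≤ (r + 3 * e * H) ^ 2 := by gcongr
    have h2 : e * H * r ≤ e * H * H := mul_le_mul_of_nonneg_left hrH (by positivity)
    have h3 : e * (e * H ^ 2) ≤ 1 * (e * H ^ 2) := mul_le_mul_of_nonneg_right he1 (by positivity)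
    have h4 : (H / n) ^ 2 = H ^ 2 * (1 / (n : ℝ) ^ 2) := by field_simp
    rw [h4]
    nlinarith
  by_cases hcase : 4 * (n : ℝ) ^ 24 ≤ δ
  · right
    intro r hr hrH
    have h1 := card_slab_le_card_ball (by omega) hu he hcase hδH hr
    have h2 := hball r 1 hr hrH (by norm_num) (by norm_num)
    rw [one_mul] at h2
    have h3 : (2 - e) ^ 2 ≤ (2 + e) ^ 2 := by nlinarith
    calc (2 - e) ^ 3 * (H / n) * ((slabZ u δ (r ^ 2)).card : ℝ)
        = (2 - e) ^ 2 * ((2 - e) * (H / n) * ((slabZ u δ (r ^ 2)).card : ℝ)) := by ring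
      _ ≤ (2 - e) ^ 2 * _ := mul_le_mul_of_nonneg_left h1 (sq_nonneg _)
      _ ≤ (2 + e) ^ 2 * ((2 + e) * δ * _) :=
        mul_le_mul h3 (mul_le_mul_of_nonneg_left h2 (by positivity)) (by positivity) (by positivity)
      _ = _ := by ring
  · push Not at hcase
    have hρ1 : 1 ≤ ρ := by
      by_contra hcon
      push Not at hcon
      have : ρ ^ 2 ≤ 1 := by nlinarith
      nlinarith
    have hρρ : ρ * (ρ * δ) = 4 * (n : ℝ) ^ 24 := by rw [← hρδ]; ring
    have hρδ0 : 0 < ρ * δ := by positivity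
    rcases card_slab_widen_or_unimodular hn hu he hδ le_rfl hcase.le hρ1 hH0 hK with h | hw1
    · exact Or.inl h
    rcases card_slab_widen_or_unimodular hn hu he hδ (δ₁ := ρ * δ) (by nlinarith)
      (by nlinarith) hρ1 hH0 hK with h | hw2
    · exact Or.inl h
    right
    intro r hr hrH
    have heH : 0 ≤ e * H := by positivity
    have h1 := hw1 r hr
    have h2 := hw2 (r + e * H) (by positivity)
    rw [hρρ] at h2
    have h3 := card_slab_le_card_ball (r := r + e * H + e * H) (by omega) hu he le_rfl
      (show 4 * (n : ℝ) ^ 24 ≤ H / n by rw [le_div_iff₀ hn0]; linarith) (by positivity)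
    rw [show r + e * H + e * H + e * H = r + 3 * e * H by ring] at h3
    have h4 := hball r 3 hr hrH (by norm_num) le_rfl
    set s0 := ((slabZ u δ (r ^ 2)).card : ℝ)
    set s1 := ((slabZ u (ρ * δ) ((r + e * H) ^ 2)).card : ℝ)
    set s2 := ((slabZ u (4 * (n : ℝ) ^ 24) ((r + e * H + e * H) ^ 2)).card : ℝ)
    set s3 := ((ballZ (Fin n) ((H / n) ^ 2 + (r + 3 * e * H) ^ 2)).card : ℝ)
    set s4 := ((ballZ (Fin n) (r ^ 2 + H ^ 2 * (1 / (n : ℝ) ^ 2 + 15 * e))).card : ℝ)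
    have hm : 0 ≤ 2 - e := by linarith
    have hp : 0 ≤ 2 + e := by linarith
    have hHn : 0 ≤ H / n := by positivity
    have k1 : (2 - e) ^ 3 * (H / n) * ρ ^ 2 * s0 ≤ (2 - e) ^ 2 * (H / n) * ρ * ((2 + e) * s1) := by
      calc _ = (2 - e) ^ 2 * (H / n) * ρ * ((2 - e) * ρ * s0) := by ring
        _ ≤ _ := mul_le_mul_of_nonneg_left h1 (by positivity)
    have k2 : (2 - e) ^ 2 * (H / n) * ρ * ((2 + e) * s1) ≤
        (2 - e) * (H / n) * (2 + e) * ((2 + e) * s2) := by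
      calc _ = (2 - e) * (H / n) * (2 + e) * ((2 - e) * ρ * s1) := by ring
        _ ≤ _ := mul_le_mul_of_nonneg_left h2 (by positivity)
    have k3 : (2 - e) * (H / n) * (2 + e) * ((2 + e) * s2) ≤
        (2 + e) ^ 2 * ((2 + e) * (4 * (n : ℝ) ^ 24) * s3) := by
      calc _ = (2 + e) ^ 2 * ((2 - e) * (H / n) * s2) := by ring
        _ ≤ _ := mul_le_mul_of_nonneg_left h3 (by positivity)
    have k4 : (2 + e) ^ 2 * ((2 + e) * (4 * (n : ℝ) ^ 24) * s3) ≤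
        (2 + e) ^ 2 * ((2 + e) * (4 * (n : ℝ) ^ 24) * s4) := by gcongr
    have k5 : ρ ^ 2 * ((2 - e) ^ 3 * (H / n) * s0) ≤ ρ ^ 2 * ((2 + e) ^ 3 * δ * s4) := by
      have : ρ ^ 2 * ((2 + e) ^ 3 * δ * s4) =
          (2 + e) ^ 2 * ((2 + e) * (4 * (n : ℝ) ^ 24) * s4) := by rw [← hρδ]; ring
      linarith
    exact le_of_mul_le_mul_left k5 (by positivity)

theorem prod_ite_eq_one_card {n : ℕ} (i₀ : Fin n) (a : ℕ) :
    ∏ i : Fin n, (if i = i₀ then 1 else a) = a ^ (n - 1) := by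
  rw [Finset.prod_ite, Finset.prod_const_one, one_mul, Finset.prod_const, Finset.filter_ne',
    Finset.card_erase_of_mem (Finset.mem_univ _), Finset.card_univ, Fintype.card_fin]

/-- Few integer points of a box are nearly orthogonal to a unimodular integer vector `y`: the
expected number is at most inversely proportional to the entries of `y`. -/
theorem card_near_hyperplane_le {n : ℕ} {y b : Fin n → ℤ} (hby : ∑ i, b i * y i = 1) {i₀ : Fin n}
    (hy : y i₀ ≠ 0) {H T : ℝ} (hyH : |(y i₀ : ℝ)| ≤ H) (hT : 0 ≤ T) (S : Finset (Fin n → ℤ))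
    (hS : ∀ c ∈ S, (∀ i, |(c i : ℝ)| ≤ H) ∧ |((∑ i, c i * y i : ℤ) : ℝ)| ≤ T) :
    (S.card : ℝ) * |(y i₀ : ℝ)| ≤ (2 * T + 1) * (3 * H) ^ (n - 1) := by
  set p : ℤ := |y i₀| with hp
  have hp0 : 0 < p := abs_pos.2 hy
  have hpH : (p : ℝ) ≤ H := by rw [hp]; exact_mod_cast hyH
  have hpy : p ∣ y i₀ := (abs_dvd _ _).2 dvd_rfl
  set K : ℤ := ⌊H⌋ with hK
  have hKH : (K : ℝ) ≤ H := Int.floor_le H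
  have hpK : p ≤ K := Int.le_floor.2 hpH
  set L : ℤ := ⌊T⌋ with hL
  have hLT : (L : ℝ) ≤ T := Int.floor_le T
  have hL0 : 0 ≤ L := Int.le_floor.2 (by simpa using hT)
  have hcK : ∀ c ∈ S, ∀ i, -K ≤ c i ∧ c i ≤ K := by
    intro c hc i
    have h1 := abs_le.1 ((hS c hc).1 i)
    refine ⟨?_, Int.le_floor.2 h1.2⟩
    have : -c i ≤ K := Int.le_floor.2 (by push_cast; linarith)
    linarith
  let f : (Fin n → ℤ) × ℤ → (Fin n → ℤ) × ℤ := fun q =>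
    (fun i => if i = i₀ then 0 else q.1 i + (q.2 * b i) % p, ∑ i, q.1 i * y i)
  let D : Finset ((Fin n → ℤ) × ℤ) :=
    (Fintype.piFinset fun i => if i = i₀ then {0} else Finset.Icc (-K) (K + p - 1)) ×ˢ
      Finset.Icc (-L) L
  have hmaps : ∀ q ∈ S ×ˢ Finset.Ico (0 : ℤ) p, f q ∈ D := by
    rintro ⟨c, t⟩ hq
    obtain ⟨hc, ht⟩ := Finset.mem_product.1 hq
    refine Finset.mem_product.2 ⟨Fintype.mem_piFinset.2 fun i => ?_, ?_⟩
    · by_cases hi : i = i₀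
      · simp [f, hi]
      · have h1 := hcK c hc i
        have h2 := Int.emod_nonneg (t * b i) hp0.ne'
        have h3 := Int.emod_lt_of_pos (t * b i) hp0
        simp only [f, hi, if_false, Finset.mem_Icc]
        constructor <;> linarith
    · have h1 := abs_le.1 (hS c hc).2
      refine Finset.mem_Icc.2 ⟨?_, Int.le_floor.2 h1.2⟩
      have : -(∑ i, c i * y i) ≤ L := Int.le_floor.2 (by push_cast at h1 ⊢; linarith)
      simp only [f]
      linarith
  have hinj : Set.InjOn f (S ×ˢ Finset.Ico (0 : ℤ) p : Finset _) := by
    rintro ⟨c, t⟩ hq ⟨c', t'⟩ hq' heq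
    obtain ⟨-, ht⟩ := Finset.mem_product.1 (Finset.mem_coe.1 hq)
    obtain ⟨-, ht'⟩ := Finset.mem_product.1 (Finset.mem_coe.1 hq')
    rw [Finset.mem_Ico] at ht ht'
    have h1 : ∀ i, (if i = i₀ then (0 : ℤ) else c i + (t * b i) % p) =
        if i = i₀ then (0 : ℤ) else c' i + (t' * b i) % p := fun i =>
      congrFun (congrArg Prod.fst heq) i
    have h2 : ∑ i, c i * y i = ∑ i, c' i * y i := congrArg Prod.snd heq
    have h3 : ∀ i, p ∣ (c i + t * b i - (c' i + t' * b i)) * y i := by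
      intro i
      by_cases hi : i = i₀
      · rw [hi]; exact hpy.mul_left _
      · refine Dvd.dvd.mul_right ?_ _
        have h4 := h1 i
        simp only [hi, if_false] at h4
        have h5 := Int.mul_ediv_add_emod (t * b i) p
        have h6 := Int.mul_ediv_add_emod (t' * b i) p
        exact ⟨t * b i / p - t' * b i / p, by linarith⟩
    have h4 : p ∣ t - t' := by
      have h5 : ∑ i, (c i + t * b i - (c' i + t' * b i)) * y i = t - t' := by
        have : ∀ i, (c i + t * b i - (c' i + t' * b i)) * y i =
            c i * y i - c' i * y i + (t - t') * (b i * y i) := fun i => by ring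
        simp only [this, Finset.sum_add_distrib, Finset.sum_sub_distrib, ← Finset.mul_sum, hby, h2]
        ring
      rw [← h5]
      exact Finset.dvd_sum fun i _ => h3 i
    have htt : t = t' := by
      have := Int.eq_zero_of_abs_lt_dvd h4 (by rw [abs_lt]; constructor <;> linarith)
      linarith
    subst htt
    have hci : ∀ i, i ≠ i₀ → c i = c' i := by
      intro i hi
      have h5 := h1 i
      simp only [hi, if_false] at h5
      linarith
    have hc0 : c i₀ = c' i₀ := by
      rw [← Finset.add_sum_erase _ _ (Finset.mem_univ i₀),
        ← Finset.add_sum_erase (a := i₀) _ (fun i => c' i * y i) (Finset.mem_univ i₀),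
        Finset.sum_congr rfl fun i hi => by rw [hci i (Finset.ne_of_mem_erase hi)]] at h2
      exact mul_right_cancel₀ hy (by linarith)
    have : c = c' := funext fun i => by
      by_cases hi : i = i₀
      · rw [hi, hc0]
      · exact hci i hi
    rw [this]
  have hcard := Finset.card_le_card_of_injOn f hmaps hinj
  have hD : D.card = (2 * K + p).toNat ^ (n - 1) * (2 * L + 1).toNat := by
    simp only [D, Finset.card_product, Fintype.card_piFinset, Int.card_Icc, apply_ite Finset.card,
      Finset.card_singleton, prod_ite_eq_one_card]
    congr 2
    · congr 1; ring
    · ring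
  rw [hD, Finset.card_product, Int.card_Ico, sub_zero] at hcard
  have hc1 : ((S.card * p.toNat : ℕ) : ℝ) ≤
      (((2 * K + p).toNat ^ (n - 1) * (2 * L + 1).toNat : ℕ) : ℝ) := by exact_mod_cast hcard
  have ht1 : ((p.toNat : ℕ) : ℝ) = |(y i₀ : ℝ)| := by
    have : ((p.toNat : ℤ) : ℝ) = (p : ℝ) := by rw [Int.toNat_of_nonneg hp0.le]
    rw [hp, Int.cast_abs] at this
    exact_mod_cast this
  have ht2 : (((2 * K + p).toNat : ℕ) : ℝ) = 2 * K + p := by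
    exact_mod_cast Int.toNat_of_nonneg (show 0 ≤ 2 * K + p by linarith)
  have ht3 : (((2 * L + 1).toNat : ℕ) : ℝ) = 2 * L + 1 := by
    exact_mod_cast Int.toNat_of_nonneg (show 0 ≤ 2 * L + 1 by linarith)
  push_cast at hc1
  rw [ht1, ht2, ht3] at hc1
  refine hc1.trans ?_
  rw [mul_comm]
  have hK0 : (0 : ℝ) ≤ K := by exact_mod_cast (hp0.le.trans hpK)
  have hp0' : (0 : ℝ) ≤ p := by exact_mod_cast hp0.le
  gcongr
  linarith

theorem sum_one_div_max_one_abs_le {Y : ℝ} (hY : 1 ≤ Y) :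
    ∑ a ∈ Finset.Icc (-⌊Y⌋) ⌊Y⌋, 1 / max 1 |(a : ℝ)| ≤ 3 + 2 * Real.log Y := by
  have key : ∀ m : ℕ, ∑ a ∈ Finset.Icc (-(m : ℤ)) m, 1 / max 1 |(a : ℝ)| =
      1 + 2 * ((harmonic m : ℚ) : ℝ) := by
    intro m
    induction m with
    | zero => simp
    | succ m ih =>
      have hI : Finset.Icc (-((m + 1 : ℕ) : ℤ)) ((m + 1 : ℕ) : ℤ) =
          insert (-((m : ℤ) + 1)) (insert ((m : ℤ) + 1) (Finset.Icc (-(m : ℤ)) m)) := by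
        ext a
        simp only [Finset.mem_insert, Finset.mem_Icc]
        push_cast
        omega
      have hmax : max (1 : ℝ) ((m : ℝ) + 1) = m + 1 :=
        max_eq_right (by linarith [m.cast_nonneg (α := ℝ)])
      have habs : |(m : ℝ) + 1| = m + 1 := abs_of_nonneg (by positivity)
      rw [hI, Finset.sum_insert, Finset.sum_insert, ih, harmonic_succ]
      · push_cast
        rw [abs_neg, habs, hmax]
        ring
      · simp
      · simp only [Finset.mem_insert, Finset.mem_Icc]
        omega
  have hY0 : (0 : ℤ) ≤ ⌊Y⌋ := Int.floor_nonneg.2 (by linarith)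
  obtain ⟨m, hm⟩ := Int.eq_ofNat_of_zero_le hY0
  rw [hm]
  rw [key]
  have h1 := harmonic_le_one_add_log m
  have h2 : (1 : ℝ) ≤ m := by
    have : (1 : ℤ) ≤ ⌊Y⌋ := Int.le_floor.2 (by simpa using hY)
    rw [hm] at this
    exact_mod_cast this
  have h3 : (m : ℝ) ≤ Y := by
    have := Int.floor_le Y
    rw [hm] at this
    exact_mod_cast this
  have h4 : Real.log m ≤ Real.log Y := Real.log_le_log (by linarith) h3
  linarith

open scoped Classical in
/-- Few integer matrices have all their rows nearly orthogonal to a common small unimodular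
vector. -/
theorem card_rows_near_hyperplane_le {n : ℕ} {H T Y : ℝ} (hT : 0 ≤ T) (hY : 1 ≤ Y) (hYH : Y ≤ H)
    (E : Finset (Fin n → Fin n → ℤ))
    (hE : ∀ X ∈ E, (∀ j i, |(X j i : ℝ)| ≤ H) ∧ ∃ y b : Fin n → ℤ, ∑ i, b i * y i = 1 ∧
      (∀ i, |(y i : ℝ)| ≤ Y) ∧ ∀ j, |((∑ i, X j i * y i : ℤ) : ℝ)| ≤ T) :
    (E.card : ℝ) ≤ ((2 * T + 1) * (3 * H) ^ (n - 1) * (3 + 2 * Real.log Y)) ^ n := by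
  have hH1 : 1 ≤ H := hY.trans hYH
  set I : Finset ℤ := Finset.Icc (-⌊Y⌋) ⌊Y⌋ with hI
  set Ys : Finset (Fin n → ℤ) :=
    (Fintype.piFinset fun _ => I).filter fun y => ∃ b : Fin n → ℤ, ∑ i, b i * y i = 1 with hYs
  let S : (Fin n → ℤ) → Finset (Fin n → ℤ) := fun y =>
    (Fintype.piFinset fun _ => Finset.Icc (-⌊H⌋) ⌊H⌋).filter fun c =>
      |((∑ i, c i * y i : ℤ) : ℝ)| ≤ T
  have hIcc : ∀ (R : ℝ) (a : ℤ), a ∈ Finset.Icc (-⌊R⌋) ⌊R⌋ ↔ |(a : ℝ)| ≤ R := by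
    intro R a
    rw [Finset.mem_Icc, abs_le, neg_le, Int.le_floor, Int.le_floor]
    push_cast
    constructor <;> rintro ⟨h1, h2⟩ <;> constructor <;> linarith
  have hsub : E ⊆ Ys.biUnion fun y => Fintype.piFinset fun _ : Fin n => S y := by
    intro X hX
    obtain ⟨hXH, y, b, hby, hy, hXy⟩ := hE X hX
    refine Finset.mem_biUnion.2 ⟨y, ?_, ?_⟩
    · exact Finset.mem_filter.2 ⟨Fintype.mem_piFinset.2 fun i => (hIcc Y _).2 (hy i), b, hby⟩
    · exact Fintype.mem_piFinset.2 fun j => Finset.mem_filter.2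
        ⟨Fintype.mem_piFinset.2 fun i => (hIcc H _).2 (hXH j i), hXy j⟩
  have h1 : (E.card : ℝ) ≤ ∑ y ∈ Ys, ((S y).card : ℝ) ^ n := by
    have := (Finset.card_le_card hsub).trans Finset.card_biUnion_le
    simp only [Fintype.card_piFinset, Finset.prod_const, Finset.card_univ, Fintype.card_fin] at this
    exact_mod_cast this
  have hC0 : 0 ≤ (2 * T + 1) * (3 * H) ^ (n - 1) := by positivity
  have h2 : ∀ y ∈ Ys, ((S y).card : ℝ) ^ n ≤
      ((2 * T + 1) * (3 * H) ^ (n - 1)) ^ n * ∏ i, 1 / max 1 |(y i : ℝ)| := by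
    intro y hy
    obtain ⟨hyI, b, hby⟩ := Finset.mem_filter.1 hy
    have hyY : ∀ i, |(y i : ℝ)| ≤ Y := fun i => (hIcc Y _).1 (Fintype.mem_piFinset.1 hyI i)
    have hne : (Finset.univ : Finset (Fin n)).Nonempty := by
      by_contra hemp
      rw [Finset.not_nonempty_iff_eq_empty] at hemp
      rw [hemp] at hby
      simp at hby
    obtain ⟨i₀, -, hmax⟩ := Finset.exists_max_image Finset.univ (fun i => |(y i : ℝ)|) hne
    have hy0 : y i₀ ≠ 0 := by
      intro h0
      have : ∀ i, y i = 0 := fun i => by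
        have := hmax i (Finset.mem_univ i)
        rw [h0, Int.cast_zero, abs_zero] at this
        exact_mod_cast abs_eq_zero.1 (le_antisymm this (abs_nonneg _))
      simp [this] at hby
    have hp1 : (1 : ℝ) ≤ |(y i₀ : ℝ)| := by exact_mod_cast Int.one_le_abs hy0
    have hcount := card_near_hyperplane_le hby hy0 ((hyY i₀).trans hYH) hT (S y) (fun c hc => by
      obtain ⟨hc1, hc2⟩ := Finset.mem_filter.1 hc
      exact ⟨fun i => (hIcc H _).1 (Fintype.mem_piFinset.1 hc1 i), hc2⟩)
    have hS : ((S y).card : ℝ) ≤ (2 * T + 1) * (3 * H) ^ (n - 1) * (1 / |(y i₀ : ℝ)|) := by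
      rw [mul_one_div, le_div_iff₀ (by linarith)]
      exact hcount
    calc ((S y).card : ℝ) ^ n ≤ ((2 * T + 1) * (3 * H) ^ (n - 1) * (1 / |(y i₀ : ℝ)|)) ^ n :=
          pow_le_pow_left₀ (Nat.cast_nonneg _) hS n
      _ = ((2 * T + 1) * (3 * H) ^ (n - 1)) ^ n * ∏ _i : Fin n, 1 / |(y i₀ : ℝ)| := by
          rw [mul_pow, Finset.prod_const, Finset.card_univ, Fintype.card_fin]
      _ ≤ _ := by
          refine mul_le_mul_of_nonneg_left (Finset.prod_le_prod (fun _ _ => by positivity)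
            fun i _ => ?_) (by positivity)
          exact one_div_le_one_div_of_le (lt_of_lt_of_le one_pos (le_max_left _ _))
            (max_le hp1 (hmax i (Finset.mem_univ i)))
  have h3 : ∑ y ∈ Ys, ∏ i, 1 / max 1 |(y i : ℝ)| ≤ (3 + 2 * Real.log Y) ^ n := by
    calc ∑ y ∈ Ys, ∏ i, 1 / max 1 |(y i : ℝ)|
        ≤ ∑ y ∈ Fintype.piFinset fun _ : Fin n => I, ∏ i, 1 / max 1 |(y i : ℝ)| :=
          Finset.sum_le_sum_of_subset_of_nonneg (Finset.filter_subset _ _) fun _ _ _ =>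
            Finset.prod_nonneg fun _ _ => by positivity
      _ = ∏ _i : Fin n, ∑ a ∈ I, 1 / max 1 |(a : ℝ)| :=
          (Finset.prod_univ_sum (fun _ : Fin n => I) fun _ (a : ℤ) => 1 / max 1 |(a : ℝ)|).symm
      _ = (∑ a ∈ I, 1 / max 1 |(a : ℝ)|) ^ n := by
          rw [Finset.prod_const, Finset.card_univ, Fintype.card_fin]
      _ ≤ _ := pow_le_pow_left₀ (Finset.sum_nonneg fun _ _ => by positivity)
          (sum_one_div_max_one_abs_le hY) n
  calc (E.card : ℝ) ≤ ∑ y ∈ Ys, ((S y).card : ℝ) ^ n := h1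
    _ ≤ ∑ y ∈ Ys, ((2 * T + 1) * (3 * H) ^ (n - 1)) ^ n * ∏ i, 1 / max 1 |(y i : ℝ)| :=
        Finset.sum_le_sum h2
    _ = ((2 * T + 1) * (3 * H) ^ (n - 1)) ^ n * ∑ y ∈ Ys, ∏ i, 1 / max 1 |(y i : ℝ)| := by
        rw [Finset.mul_sum]
    _ ≤ _ := by
        rw [mul_pow _ (3 + 2 * Real.log Y)]
        exact mul_le_mul_of_nonneg_left h3 (by positivity)

/-- There is a unit vector orthogonal to all rows but one of a square matrix. -/
theorem exists_unit_normal {n : ℕ} (C : Fin n → Fin n → ℝ) (j : Fin n) :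
    ∃ u : Fin n → ℝ, ∑ k, u k ^ 2 = 1 ∧ ∀ i, i ≠ j → ∑ k, u k * C i k = 0 := by
  set M : Matrix (Fin n) (Fin n) ℝ := Matrix.of (Function.update C j 0) with hM
  have hdet : M.det = 0 := Matrix.det_eq_zero_of_row_eq_zero j fun k => by simp [hM]
  obtain ⟨v, hv0, hv⟩ := Matrix.exists_mulVec_eq_zero_iff.2 hdet
  have hpos : 0 < ∑ k, v k ^ 2 := by
    obtain ⟨k, hk⟩ := Function.ne_iff.1 hv0
    exact Finset.sum_pos' (fun _ _ => sq_nonneg _) ⟨k, Finset.mem_univ k, by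
      have : v k ≠ 0 := hk
      positivity⟩
  have hs : Real.sqrt (∑ k, v k ^ 2) ≠ 0 := (Real.sqrt_pos.2 hpos).ne'
  refine ⟨fun k => v k / Real.sqrt (∑ k, v k ^ 2), ?_, ?_⟩
  · simp only [div_pow, ← Finset.sum_div, Real.sq_sqrt hpos.le]
    exact div_self hpos.ne'
  · intro i hi
    have h1 : ∑ k, C i k * v k = 0 := by
      have := congrFun hv i
      simpa [Matrix.mulVec, dotProduct, hM, hi] using this
    calc ∑ k, v k / Real.sqrt (∑ k, v k ^ 2) * C i k
        = (∑ k, C i k * v k) / Real.sqrt (∑ k, v k ^ 2) := by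
          rw [Finset.sum_div]
          exact Finset.sum_congr rfl fun k _ => by ring
      _ = 0 := by rw [h1, zero_div]

theorem opNorm_le_frobNorm {n : ℕ} (M : Matrix (Fin n) (Fin n) ℝ) : opNorm M ≤ frobNorm M := by
  refine Real.sSup_le ?_ (Real.sqrt_nonneg _)
  rintro t ⟨v, hv, rfl⟩
  have hv1 : ∑ i, v i ^ 2 = 1 := by
    unfold eNorm at hv
    rwa [Real.sqrt_eq_one] at hv
  refine Real.sqrt_le_sqrt (Finset.sum_le_sum fun i _ => ?_)
  have := Finset.sum_mul_sq_le_sq_mul_sq Finset.univ (M i) v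
  rw [hv1, mul_one] at this
  exact this

theorem opNorm_nonneg {n : ℕ} (M : Matrix (Fin n) (Fin n) ℝ) : 0 ≤ opNorm M := by
  refine Real.sSup_nonneg ?_
  rintro t ⟨v, -, rfl⟩
  exact Real.sqrt_nonneg _

theorem frobNorm_sq {n : ℕ} (M : Matrix (Fin n) (Fin n) ℝ) :
    frobNorm M ^ 2 = ∑ i, ∑ j, M i j ^ 2 :=
  Real.sq_sqrt (Finset.sum_nonneg fun _ _ => Finset.sum_nonneg fun _ _ => sq_nonneg _)

/-- An ill-conditioned matrix has a row close to the span of the others. -/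
theorem exists_row_near_of_le_kE {n : ℕ} (hn : 1 ≤ n) (M : Matrix (Fin n) (Fin n) ℝ) {w : ℝ}
    (hw : 0 < w) (hk : ENNReal.ofReal (w * (n : ℝ) ^ ((5 : ℝ) / 2)) ≤ kE M)
    (u : Fin n → Fin n → ℝ) (hu : ∀ j, ∑ k, u j k ^ 2 = 1)
    (hperp : ∀ j i, i ≠ j → ∑ k, u j k * M i k = 0) :
    ∃ j, |∑ k, u j k * M j k| * (w * (n : ℝ) ^ 2) ≤ frobNorm M := by
  have hn1 : (1 : ℝ) ≤ n := by exact_mod_cast hn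
  have hn0 : (0 : ℝ) < n := by linarith
  have hF0 : 0 ≤ frobNorm M := Real.sqrt_nonneg _
  by_cases hdet : IsUnit M.det
  · have hk2 : w * (n : ℝ) ^ ((5 : ℝ) / 2) ≤ opNorm M * opNorm M⁻¹ := by
      unfold kE at hk
      rw [if_pos hdet] at hk
      exact (ENNReal.ofReal_le_ofReal_iff
        (mul_nonneg (opNorm_nonneg _) (opNorm_nonneg _))).1 hk
    have hk3 : w * (n : ℝ) ^ ((5 : ℝ) / 2) ≤ frobNorm M * frobNorm M⁻¹ :=
      hk2.trans (mul_le_mul (opNorm_le_frobNorm _) (opNorm_le_frobNorm _) (opNorm_nonneg _) hF0)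
    have hpow : ((n : ℝ) ^ ((5 : ℝ) / 2)) ^ 2 = (n : ℝ) ^ 5 := by
      rw [← Real.rpow_natCast, ← Real.rpow_mul hn0.le]
      norm_num
    have hk4 : w ^ 2 * (n : ℝ) ^ 5 ≤ frobNorm M ^ 2 * frobNorm M⁻¹ ^ 2 := by
      rw [← hpow, ← mul_pow, ← mul_pow]
      exact pow_le_pow_left₀ (by positivity) hk3 2
    have : Nonempty (Fin n) := ⟨⟨0, hn⟩⟩
    obtain ⟨j, -, hj⟩ := Finset.exists_max_image Finset.univ
      (fun j => ∑ i, M⁻¹ i j ^ 2) Finset.univ_nonempty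
    refine ⟨j, ?_⟩
    set t := ∑ k, u j k * M j k with ht
    have hMu : M.mulVec (u j) = Pi.single j t := by
      ext i
      by_cases hi : i = j
      · subst hi
        simp only [Matrix.mulVec, dotProduct, Pi.single_eq_same, ht]
        exact Finset.sum_congr rfl fun k _ => mul_comm _ _
      · rw [Pi.single_eq_of_ne hi, ← hperp j i hi]
        simp only [Matrix.mulVec, dotProduct]
        exact Finset.sum_congr rfl fun k _ => mul_comm _ _
    have hcol : ∀ i, u j i = M⁻¹ i j * t := by
      intro i
      have h1 : M⁻¹.mulVec (M.mulVec (u j)) = u j := by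
        rw [Matrix.mulVec_mulVec, Matrix.nonsing_inv_mul M hdet, Matrix.one_mulVec]
      have h2 := congrFun h1 i
      rw [hMu] at h2
      simpa [Matrix.mulVec_single] using h2.symm
    have h1 : t ^ 2 * ∑ i, M⁻¹ i j ^ 2 = 1 := by
      rw [← hu j, Finset.mul_sum]
      exact Finset.sum_congr rfl fun i _ => by rw [hcol]; ring
    have h2 : frobNorm M⁻¹ ^ 2 ≤ n * ∑ i, M⁻¹ i j ^ 2 := by
      rw [frobNorm_sq, Finset.sum_comm]
      calc ∑ k, ∑ i, M⁻¹ i k ^ 2 ≤ ∑ _k : Fin n, ∑ i, M⁻¹ i j ^ 2 :=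
            Finset.sum_le_sum fun k _ => hj k (Finset.mem_univ k)
        _ = _ := by simp
    have h3 : t ^ 2 * (w ^ 2 * (n : ℝ) ^ 5) ≤ frobNorm M ^ 2 * n := by
      calc t ^ 2 * (w ^ 2 * (n : ℝ) ^ 5) ≤ t ^ 2 * (frobNorm M ^ 2 * frobNorm M⁻¹ ^ 2) := by gcongr
        _ ≤ t ^ 2 * (frobNorm M ^ 2 * (n * ∑ i, M⁻¹ i j ^ 2)) := by gcongr
        _ = frobNorm M ^ 2 * n * (t ^ 2 * ∑ i, M⁻¹ i j ^ 2) := by ring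
        _ = _ := by rw [h1, mul_one]
    have h4 : (|t| * (w * (n : ℝ) ^ 2)) ^ 2 ≤ frobNorm M ^ 2 := by
      refine le_of_mul_le_mul_right ?_ hn0
      calc (|t| * (w * (n : ℝ) ^ 2)) ^ 2 * n = t ^ 2 * (w ^ 2 * (n : ℝ) ^ 5) := by
            rw [mul_pow, sq_abs]; ring
        _ ≤ _ := h3
    exact le_of_sq_le_sq h4 hF0
  · have hdet0 : M.det = 0 := by
      by_contra h
      exact hdet (isUnit_iff_ne_zero.2 h)
    obtain ⟨v, hv0, hv⟩ := Matrix.exists_vecMul_eq_zero_iff.2 hdet0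
    obtain ⟨j, hj⟩ := Function.ne_iff.1 hv0
    refine ⟨j, ?_⟩
    have hvj : v j ≠ 0 := hj
    have h1 : ∑ i, v i * ∑ k, u j k * M i k = 0 := by
      have h2 : ∀ k, ∑ i, v i * M i k = 0 := fun k => congrFun hv k
      calc ∑ i, v i * ∑ k, u j k * M i k = ∑ k, u j k * ∑ i, v i * M i k := by
            simp only [Finset.mul_sum]
            rw [Finset.sum_comm]
            exact Finset.sum_congr rfl fun k _ => Finset.sum_congr rfl fun i _ => by ring
        _ = 0 := by simp [h2]
    rw [Finset.sum_eq_single j (fun i _ hi => by rw [hperp j i hi, mul_zero])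
      (fun h => absurd (Finset.mem_univ j) h)] at h1
    rw [(mul_eq_zero.1 h1).resolve_left hvj]
    simpa using hF0

/-- The integer matrices whose squared Frobenius norm is at most `R`. -/
def matBall (n : ℕ) (R : ℝ) : Finset (Fin n → Fin n → ℤ) :=
  (ballZ (Fin n × Fin n) R).map (Equiv.curry (Fin n) (Fin n) ℤ).toEmbedding

theorem card_matBall (n : ℕ) (R : ℝ) : (matBall n R).card = (ballZ (Fin n × Fin n) R).card :=
  Finset.card_map _

theorem mem_matBall {n : ℕ} {R : ℝ} {X : Fin n → Fin n → ℤ} :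
    X ∈ matBall n R ↔ ∑ i, ∑ j, (X i j : ℝ) ^ 2 ≤ R := by
  rw [matBall, Finset.mem_map_equiv, mem_ballZ, Fintype.sum_prod_type]
  rfl

theorem sum_sum_sq_update {n : ℕ} (X : Fin n → Fin n → ℤ) (j : Fin n) (z : Fin n → ℤ) :
    ∑ i, ∑ k, (Function.update X j z i k : ℝ) ^ 2 =
      ∑ i, ∑ k, (Function.update X j 0 i k : ℝ) ^ 2 + ∑ k, (z k : ℝ) ^ 2 := by
  rw [← Finset.add_sum_erase _ _ (Finset.mem_univ j),
    ← Finset.add_sum_erase _ (fun i => ∑ k, (Function.update X j 0 i k : ℝ) ^ 2)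
      (Finset.mem_univ j)]
  have h : ∀ z' : Fin n → ℤ, ∑ i ∈ Finset.univ.erase j,
      ∑ k, (Function.update X j z' i k : ℝ) ^ 2 =
        ∑ i ∈ Finset.univ.erase j, ∑ k, (X i k : ℝ) ^ 2 := fun z' =>
    Finset.sum_congr rfl fun i hi => by rw [Function.update_of_ne (Finset.ne_of_mem_erase hi)]
  rw [h, h]
  simp
  ring

open scoped Classical in
/-- Summing a slab estimate for the `j`-th row over all choices of the other rows. -/
theorem card_matrices_row_slab_le {n : ℕ} (j : Fin n) (u : (Fin n → Fin n → ℤ) → Fin n → ℝ)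
    (good : (Fin n → Fin n → ℤ) → Prop) {α β δ κ H : ℝ} (hH : 0 ≤ H) (hα : 0 ≤ α)
    (hβ : 0 ≤ β)
    (hslab : ∀ C, good C → ∀ r : ℝ, 0 ≤ r → r ≤ H →
      α * ((slabZ (u C) δ (r ^ 2)).card : ℝ) ≤ β * ((ballZ (Fin n) (r ^ 2 + κ)).card : ℝ)) :
    α * (((matBall n (H ^ 2)).filter fun X => good (Function.update X j 0) ∧
      |pairing (u (Function.update X j 0)) (X j)| ≤ δ).card : ℝ) ≤
        β * ((matBall n (H ^ 2 + κ)).card : ℝ) := by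
  set G := (matBall n (H ^ 2)).filter fun X => good (Function.update X j 0) ∧
      |pairing (u (Function.update X j 0)) (X j)| ≤ δ with hG
  let c : (Fin n → Fin n → ℤ) → (Fin n → Fin n → ℤ) := fun X => Function.update X j 0
  have hinjrow : ∀ X X' : Fin n → Fin n → ℤ, c X = c X' → X j = X' j → X = X' := by
    intro X X' h1 h2
    funext i
    by_cases hi : i = j
    · rw [hi, h2]
    · have := congrFun h1 i
      simpa [c, Function.update_of_ne hi] using this
  have h1 : (G.card : ℝ) = ∑ C ∈ G.image c, ((G.filter fun X => c X = C).card : ℝ) := by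
    exact_mod_cast Finset.card_eq_sum_card_fiberwise fun X hX => Finset.mem_image_of_mem c hX
  have h2 : ∑ C ∈ G.image c, (((matBall n (H ^ 2 + κ)).filter fun X => c X = C).card : ℝ) ≤
      ((matBall n (H ^ 2 + κ)).card : ℝ) := by
    have := (Finset.sum_card_fiberwise_eq_card_filter (matBall n (H ^ 2 + κ)) (G.image c) c).trans_le
      (Finset.card_filter_le _ _)
    exact_mod_cast this
  have h3 : ∀ C ∈ G.image c, α * ((G.filter fun X => c X = C).card : ℝ) ≤
      β * (((matBall n (H ^ 2 + κ)).filter fun X => c X = C).card : ℝ) := by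
    intro C hC
    obtain ⟨X₀, hX₀, rfl⟩ := Finset.mem_image.1 hC
    obtain ⟨hX₀R, hgood, -⟩ := Finset.mem_filter.1 hX₀
    have hnorm : ∀ X, c X = c X₀ → ∑ i, ∑ k, (X i k : ℝ) ^ 2 =
        ∑ i, ∑ k, (c X₀ i k : ℝ) ^ 2 + ∑ k, (X j k : ℝ) ^ 2 := by
      intro X hX
      have := sum_sum_sq_update X j (X j)
      rw [Function.update_eq_self] at this
      rw [this, ← hX]
    set ν := ∑ i, ∑ k, (c X₀ i k : ℝ) ^ 2 with hν
    have hν0 : 0 ≤ ν := Finset.sum_nonneg fun _ _ => Finset.sum_nonneg fun _ _ => sq_nonneg _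
    have hνH : ν ≤ H ^ 2 := by
      have h4 := hnorm X₀ rfl
      have h5 := mem_matBall.1 hX₀R
      have h6 : 0 ≤ ∑ k, (X₀ j k : ℝ) ^ 2 := Finset.sum_nonneg fun _ _ => sq_nonneg _
      linarith
    have hr2 : Real.sqrt (H ^ 2 - ν) ^ 2 = H ^ 2 - ν := Real.sq_sqrt (by linarith)
    have hrH : Real.sqrt (H ^ 2 - ν) ≤ H := Real.sqrt_le_iff.2 ⟨hH, by linarith⟩
    have key := hslab (c X₀) hgood _ (Real.sqrt_nonneg _) hrH
    rw [hr2] at key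
    have k1 : (G.filter fun X => c X = c X₀).card ≤ (slabZ (u (c X₀)) δ (H ^ 2 - ν)).card := by
      refine Finset.card_le_card_of_injOn (fun X => X j) ?_ ?_
      · intro X hX
        obtain ⟨hXG, hXc⟩ := Finset.mem_filter.1 (Finset.mem_coe.1 hX)
        obtain ⟨hXR, -, hXδ⟩ := Finset.mem_filter.1 hXG
        have h4 := hnorm X hXc
        have h5 := mem_matBall.1 hXR
        refine Finset.mem_coe.2 (mem_slabZ.2 ⟨by linarith, ?_⟩)
        rw [← hXc]
        exact hXδ
      · intro X hX X' hX' heq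
        have h4 := (Finset.mem_filter.1 (Finset.mem_coe.1 hX)).2
        have h5 := (Finset.mem_filter.1 (Finset.mem_coe.1 hX')).2
        exact hinjrow X X' (h4.trans h5.symm) heq
    have k2 : (ballZ (Fin n) (H ^ 2 - ν + κ)).card ≤
        ((matBall n (H ^ 2 + κ)).filter fun X => c X = c X₀).card := by
      refine Finset.card_le_card_of_injOn (fun z => Function.update X₀ j z) ?_ ?_
      · intro z hz
        have h4 := mem_ballZ.1 (Finset.mem_coe.1 hz)
        have h5 : c (Function.update X₀ j z) = c X₀ := Function.update_idem _ _ _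
        refine Finset.mem_coe.2 (Finset.mem_filter.2 ⟨mem_matBall.2 ?_, h5⟩)
        rw [hnorm _ h5, Function.update_self]
        linarith
      · exact fun z _ z' _ h => Function.update_injective _ _ h
    calc α * ((G.filter fun X => c X = c X₀).card : ℝ)
        ≤ α * ((slabZ (u (c X₀)) δ (H ^ 2 - ν)).card : ℝ) := by gcongr
      _ ≤ β * ((ballZ (Fin n) (H ^ 2 - ν + κ)).card : ℝ) := key
      _ ≤ _ := by gcongr
  rw [h1, Finset.mul_sum]
  refine (Finset.sum_le_sum h3).trans ?_
  rw [← Finset.mul_sum]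
  exact mul_le_mul_of_nonneg_left h2 hβ

open MeasureTheory Pointwise in
theorem volume_sum_sq_le (ι : Type*) [Fintype ι] {R : ℝ} (hR : 0 < R) :
    volume {x : ι → ℝ | ∑ i, x i ^ 2 ≤ R ^ 2} =
      ENNReal.ofReal (R ^ Fintype.card ι) * volume {x : ι → ℝ | ∑ i, x i ^ 2 ≤ 1} := by
  have h : {x : ι → ℝ | ∑ i, x i ^ 2 ≤ R ^ 2} = R • {x : ι → ℝ | ∑ i, x i ^ 2 ≤ 1} := by
    ext x
    rw [Set.mem_smul_set_iff_inv_smul_mem₀ hR.ne']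
    simp only [Set.mem_ofPred_eq, Pi.smul_apply, smul_eq_mul, mul_pow, ← Finset.mul_sum, inv_pow]
    rw [inv_mul_le_iff₀ (by positivity), mul_one]
  rw [h, Measure.addHaar_smul, Module.finrank_fintype_fun_eq_card, abs_of_nonneg (by positivity)]

open MeasureTheory in
theorem volume_floor_eq {ι : Type*} [Fintype ι] (S : Finset (ι → ℤ)) :
    volume {x : ι → ℝ | (fun i => ⌊x i⌋) ∈ S} = S.card := by
  have hcube : ∀ v : ι → ℤ, {x : ι → ℝ | (fun i => ⌊x i⌋) = v} =
      Set.pi Set.univ fun i => Set.Ico (v i : ℝ) (v i + 1) := by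
    intro v
    ext x
    simp [funext_iff, Int.floor_eq_iff, Set.mem_pi]
  have hunion : {x : ι → ℝ | (fun i => ⌊x i⌋) ∈ S} =
      ⋃ v ∈ S, {x : ι → ℝ | (fun i => ⌊x i⌋) = v} := by
    ext x
    simp
  rw [hunion, measure_biUnion_finset]
  · simp [hcube, Real.volume_pi_Ico]
  · intro v _ v' _ hvv'
    refine Set.disjoint_left.2 fun x hx hx' => hvv' ?_
    exact (hx : _ = v).symm.trans hx'
  · intro v _
    rw [hcube]
    exact MeasurableSet.univ_pi fun _ => measurableSet_Ico

open MeasureTheory in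
/-- Comparison of the numbers of integer points in two concentric balls. -/
theorem card_ballZ_mul_le (ι : Type*) [Fintype ι] {R R' : ℝ} (hR' : 0 < R')
    (hR : (Fintype.card ι : ℝ) < R) :
    ((ballZ ι (R' ^ 2)).card : ℝ) * (R - Fintype.card ι) ^ Fintype.card ι ≤
      ((ballZ ι (R ^ 2)).card : ℝ) * (R' + Fintype.card ι) ^ Fintype.card ι := by
  set N := Fintype.card ι with hN
  have hN0 : (0 : ℝ) ≤ N := Nat.cast_nonneg _
  have hfrac : ∀ x : ι → ℝ, ∑ i, (x i - ⌊x i⌋) ^ 2 ≤ (N : ℝ) ^ 2 := by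
    intro x
    calc ∑ i, (x i - ⌊x i⌋) ^ 2 ≤ ∑ _i : ι, (1 : ℝ) := Finset.sum_le_sum fun i _ => by
          have h1 := Int.floor_le (x i)
          have h2 := Int.lt_floor_add_one (x i)
          nlinarith
      _ = N := by simp [hN]
      _ ≤ (N : ℝ) ^ 2 := by exact_mod_cast Nat.le_self_pow (by norm_num) N
  have h1 : ((ballZ ι (R' ^ 2)).card : ℝ≥0∞) ≤
      ENNReal.ofReal ((R' + N) ^ N) * volume {x : ι → ℝ | ∑ i, x i ^ 2 ≤ 1} := by
    rw [← volume_floor_eq, ← volume_sum_sq_le ι (by linarith)]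
    refine measure_mono fun x hx => ?_
    have h2 := sum_add_sq_le hR'.le hN0 (mem_ballZ.1 hx) (hfrac x)
    simpa using h2
  have h2 : ENNReal.ofReal ((R - N) ^ N) * volume {x : ι → ℝ | ∑ i, x i ^ 2 ≤ 1} ≤
      ((ballZ ι (R ^ 2)).card : ℝ≥0∞) := by
    rw [← volume_floor_eq, ← volume_sum_sq_le ι (by linarith)]
    refine measure_mono fun x hx => mem_ballZ.2 ?_
    have h3 : ∑ i, (-(x i - ⌊x i⌋)) ^ 2 ≤ (N : ℝ) ^ 2 := by simpa only [neg_sq] using hfrac x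
    have h2 := sum_add_sq_le (by linarith) hN0 hx h3
    rw [sub_add_cancel] at h2
    refine le_of_eq_of_le (Finset.sum_congr rfl fun i _ => ?_) h2
    ring
  have h3 : ((ballZ ι (R' ^ 2)).card : ℝ≥0∞) * ENNReal.ofReal ((R - N) ^ N) ≤
      ((ballZ ι (R ^ 2)).card : ℝ≥0∞) * ENNReal.ofReal ((R' + N) ^ N) := by
    calc _ ≤ ENNReal.ofReal ((R' + N) ^ N) * volume {x : ι → ℝ | ∑ i, x i ^ 2 ≤ 1} *
          ENNReal.ofReal ((R - N) ^ N) := by gcongr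
      _ = ENNReal.ofReal ((R - N) ^ N) * volume {x : ι → ℝ | ∑ i, x i ^ 2 ≤ 1} *
          ENNReal.ofReal ((R' + N) ^ N) := by ring
      _ ≤ _ := by gcongr
  have h4 : 0 ≤ (R - N) ^ N := pow_nonneg (by linarith) _
  have h5 : 0 ≤ (R' + N) ^ N := pow_nonneg (by linarith) _
  rw [← ENNReal.ofReal_natCast, ← ENNReal.ofReal_natCast, ← ENNReal.ofReal_mul (Nat.cast_nonneg _),
    ← ENNReal.ofReal_mul (Nat.cast_nonneg _),
    ENNReal.ofReal_le_ofReal_iff (mul_nonneg (Nat.cast_nonneg _) h5)] at h3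
  exact h3

theorem exp_fifty_one_hundredths_lt : Real.exp (51 / 100) < 1.666 := by
  have h1 : Real.exp (51 / 100) ^ 2 = Real.exp 1 * Real.exp (1 / 50) := by
    rw [← Real.exp_nat_mul, ← Real.exp_add]; norm_num
  have h2 : Real.exp (1 / 50) ≤ 50 / 49 := by
    have h3 := Real.one_sub_le_exp_neg (1 / 50)
    rw [Real.exp_neg] at h3
    have h4 := (le_inv_comm₀ (by norm_num) (Real.exp_pos _)).1 h3
    norm_num at h4 ⊢
    exact h4
  have h3 := Real.exp_one_lt_d9
  have h4 : Real.exp (51 / 100) ^ 2 < 1.666 ^ 2 := by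
    rw [h1]
    nlinarith [Real.exp_pos (1 / 50)]
  exact lt_of_pow_lt_pow_left₀ 2 (by norm_num) h4

/-- Bernoulli's inequality for the ratio of the radii of two balls of nearly the same size. -/
theorem one_sub_le_pow_of_pow_le {n : ℕ} (hn : 2 ≤ n) {H : ℝ} (hH : (n : ℝ) ^ 30 ≤ H) :
    0.9999 * H ^ (n ^ 2) ≤ (H - (n ^ 2 : ℕ)) ^ (n ^ 2) := by
  have hn2 : (2 : ℝ) ≤ n := by exact_mod_cast hn
  have hH0 : 0 < H := lt_of_lt_of_le (by positivity) hH
  have hn26 : (2 : ℝ) ^ 26 ≤ (n : ℝ) ^ 26 := pow_le_pow_left₀ (by norm_num) hn2 _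
  have hsmall : (n : ℝ) ^ 4 / H ≤ 0.0001 := by
    rw [div_le_iff₀ hH0]
    have h1 : (n : ℝ) ^ 30 = (n : ℝ) ^ 26 * (n : ℝ) ^ 4 := by ring
    have h2 : (0 : ℝ) < (n : ℝ) ^ 4 := by positivity
    nlinarith
  have h4 : (n : ℝ) ^ 2 / H ≤ 1 := by
    refine le_trans ?_ (hsmall.trans (by norm_num))
    gcongr
    · linarith
    · norm_num
  have h5 := one_add_mul_le_pow (a := -((n : ℝ) ^ 2 / H)) (by linarith) (n ^ 2)
  have h6 : (H - (n ^ 2 : ℕ)) ^ (n ^ 2) = H ^ (n ^ 2) * (1 + -((n : ℝ) ^ 2 / H)) ^ (n ^ 2) := by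
    rw [← mul_pow]
    congr 1
    push_cast
    field_simp
    ring
  have h7 : (1 : ℝ) + (n ^ 2 : ℕ) * -((n : ℝ) ^ 2 / H) = 1 - (n : ℝ) ^ 4 / H := by
    push_cast; ring
  rw [h6, mul_comm (0.9999 : ℝ)]
  refine mul_le_mul_of_nonneg_left ?_ (by positivity)
  linarith

theorem card_ballZ_inflate_le {n : ℕ} (hn : 2 ≤ n) {H : ℝ} (hH : (n : ℝ) ^ 30 ≤ H) :
    ((ballZ (Fin n × Fin n) (H ^ 2 + H ^ 2 * (1 / (n : ℝ) ^ 2 + 15 * (1 / (n : ℝ) ^ 12)))).card : ℝ) ≤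
      1.67 * ((ballZ (Fin n × Fin n) (H ^ 2)).card : ℝ) := by
  have hn2 : (2 : ℝ) ≤ n := by exact_mod_cast hn
  have hn0 : (0 : ℝ) < n := by linarith
  have hH0 : 0 < H := lt_of_lt_of_le (by positivity) hH
  have hcard : Fintype.card (Fin n × Fin n) = n ^ 2 := by simp [sq]
  set ε : ℝ := 1 / (n : ℝ) ^ 2 + 15 * (1 / (n : ℝ) ^ 12) with hε
  have hε0 : 0 < ε := by positivity
  have hball : H ^ 2 + H ^ 2 * ε ≤ (H * (1 + ε / 2)) ^ 2 := by nlinarith [sq_nonneg (H * ε)]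
  have h1 : ((ballZ (Fin n × Fin n) (H ^ 2 + H ^ 2 * ε)).card : ℝ) ≤
      ((ballZ (Fin n × Fin n) ((H * (1 + ε / 2)) ^ 2)).card : ℝ) :=
    Nat.cast_le.2 (Finset.card_le_card (ballZ_mono hball))
  have hN : (((n ^ 2 : ℕ) : ℕ) : ℝ) < H := by
    push_cast
    exact lt_of_lt_of_le (pow_lt_pow_right₀ (by linarith) (by norm_num)) hH
  have h2 := card_ballZ_mul_le (Fin n × Fin n) (R' := H * (1 + ε / 2)) (R := H) (by positivity)
    (by rw [hcard]; exact hN)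
  rw [hcard] at h2
  have h3 := one_sub_le_pow_of_pow_le hn hH
  have h4 : (H * (1 + ε / 2) + (n ^ 2 : ℕ)) ^ (n ^ 2) ≤ H ^ (n ^ 2) * 1.666 := by
    have h5 : H * (1 + ε / 2) + (n ^ 2 : ℕ) = H * ((ε / 2 + (n : ℝ) ^ 2 / H) + 1) := by
      push_cast; field_simp; ring
    rw [h5, mul_pow]
    refine mul_le_mul_of_nonneg_left ?_ (by positivity)
    calc ((ε / 2 + (n : ℝ) ^ 2 / H) + 1) ^ (n ^ 2)
        ≤ Real.exp (ε / 2 + (n : ℝ) ^ 2 / H) ^ (n ^ 2) :=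
          pow_le_pow_left₀ (by positivity) (Real.add_one_le_exp _) _
      _ = Real.exp ((n ^ 2 : ℕ) * (ε / 2 + (n : ℝ) ^ 2 / H)) := by rw [← Real.exp_nat_mul]
      _ ≤ Real.exp (51 / 100) := by
          refine Real.exp_le_exp.2 ?_
          have h6 : ((n ^ 2 : ℕ) : ℝ) * (ε / 2 + (n : ℝ) ^ 2 / H) =
              1 / 2 + 15 / 2 * (1 / (n : ℝ) ^ 10) + (n : ℝ) ^ 4 / H := by
            rw [hε]; push_cast; field_simp
          have h7 : 1 / (n : ℝ) ^ 10 ≤ 1 / 2 ^ 10 :=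
            one_div_le_one_div_of_le (by norm_num) (pow_le_pow_left₀ (by norm_num) hn2 _)
          have h8 : (n : ℝ) ^ 4 / H ≤ 1 / 2 ^ 26 := by
            rw [div_le_div_iff₀ hH0 (by norm_num), one_mul]
            refine le_trans ?_ hH
            rw [show (n : ℝ) ^ 30 = (n : ℝ) ^ 4 * (n : ℝ) ^ 26 by ring]
            exact mul_le_mul_of_nonneg_left (pow_le_pow_left₀ (by norm_num) hn2 _) (by positivity)
          rw [h6]
          norm_num at h7 h8 ⊢
          linarith
      _ ≤ _ := exp_fifty_one_hundredths_lt.le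
  set a := ((ballZ (Fin n × Fin n) ((H * (1 + ε / 2)) ^ 2)).card : ℝ)
  set b := ((ballZ (Fin n × Fin n) (H ^ 2)).card : ℝ)
  have ha : 0 ≤ a := Nat.cast_nonneg _
  have hb : 0 ≤ b := Nat.cast_nonneg _
  have h5 : a * (0.9999 * H ^ (n ^ 2)) ≤ b * (H ^ (n ^ 2) * 1.666) :=
    (mul_le_mul_of_nonneg_left h3 ha).trans (h2.trans (mul_le_mul_of_nonneg_left h4 hb))
  have h6 : (0.9999 * a) ≤ 1.666 * b := by
    refine le_of_mul_le_mul_right ?_ (show 0 < H ^ (n ^ 2) by positivity)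
    linarith
  linarith

theorem pow_div_le_card_ballZ {n : ℕ} (hn : 1 ≤ n) {H : ℝ} (hH : 0 ≤ H) :
    (H / n) ^ (n ^ 2) ≤ ((ballZ (Fin n × Fin n) (H ^ 2)).card : ℝ) := by
  have hn0 : (0 : ℝ) < n := by exact_mod_cast hn
  set K : ℕ := ⌊H / n⌋₊ with hK
  have hK1 : (K : ℝ) ≤ H / n := Nat.floor_le (by positivity)
  have hK2 : H / n ≤ K + 1 := (Nat.lt_floor_add_one _).le
  have hsub : (Fintype.piFinset fun _ : Fin n × Fin n => Finset.Icc (0 : ℤ) K) ⊆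
      ballZ (Fin n × Fin n) (H ^ 2) := by
    intro v hv
    rw [mem_ballZ]
    have h1 : ∀ p, (v p : ℝ) ^ 2 ≤ (H / n) ^ 2 := fun p => by
      obtain ⟨h2, h3⟩ := Finset.mem_Icc.1 (Fintype.mem_piFinset.1 hv p)
      have h4 : (0 : ℝ) ≤ v p := by exact_mod_cast h2
      have h5 : (v p : ℝ) ≤ K := by exact_mod_cast h3
      exact pow_le_pow_left₀ h4 (h5.trans hK1) 2
    calc ∑ p, (v p : ℝ) ^ 2 ≤ ∑ _p : Fin n × Fin n, (H / n) ^ 2 :=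
          Finset.sum_le_sum fun p _ => h1 p
      _ = H ^ 2 := by
        simp only [Finset.sum_const, Finset.card_univ, Fintype.card_prod, Fintype.card_fin,
          nsmul_eq_mul]
        push_cast
        field_simp
  have hcard := Finset.card_le_card hsub
  rw [Fintype.card_piFinset, Finset.prod_const, Int.card_Icc, Finset.card_univ, Fintype.card_prod,
    Fintype.card_fin] at hcard
  have h1 : (((K : ℤ) + 1 - 0).toNat) = K + 1 := by omega
  rw [h1, ← sq] at hcard
  calc (H / n) ^ (n ^ 2) ≤ ((K : ℝ) + 1) ^ (n ^ 2) := pow_le_pow_left₀ (by positivity) hK2 _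
    _ ≤ _ := by exact_mod_cast hcard

theorem gcd_ne_one_subset {ι : Type*} [Fintype ι] {v : ι → ℤ} {H : ℝ} (hH : 0 ≤ H)
    (hv : ∑ i, (v i : ℝ) ^ 2 ≤ H ^ 2) (hv0 : v ≠ 0) (hg : Finset.univ.gcd v ≠ 1) :
    ∃ d ∈ Finset.Icc 2 ⌊H⌋₊, ∃ v' ∈ ballZ ι ((H / d) ^ 2), (fun i => (d : ℤ) * v' i) = v := by
  set g := Finset.univ.gcd v with hgdef
  have hg0 : 0 ≤ g := Int.nonneg_of_normalize_eq_self Finset.normalize_gcd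
  obtain ⟨i₀, hi₀⟩ := Function.ne_iff.1 hv0
  have hgne : g ≠ 0 := Finset.gcd_ne_zero_iff.2 ⟨i₀, Finset.mem_univ _, hi₀⟩
  have hdvd : ∀ i, g ∣ v i := fun i => Finset.gcd_dvd (Finset.mem_univ i)
  choose v' hv' using hdvd
  obtain ⟨d, hd⟩ := Int.eq_ofNat_of_zero_le hg0
  have hd2 : 2 ≤ d := by omega
  have hd0 : (0 : ℝ) < d := by exact_mod_cast (by omega : 0 < d)
  have hvi : ∀ i, (v i : ℝ) = d * v' i := fun i => by rw [hv' i, hd]; push_cast; rfl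
  refine ⟨d, Finset.mem_Icc.2 ⟨hd2, Nat.le_floor ?_⟩, v', mem_ballZ.2 ?_, ?_⟩
  · have h1 : |(v i₀ : ℝ)| ≤ H :=
      abs_le_of_sq_le_sq ((Finset.single_le_sum (f := fun i => (v i : ℝ) ^ 2)
        (fun _ _ => sq_nonneg _) (Finset.mem_univ i₀)).trans hv) hH
    have h2 : (g : ℝ) ≤ |(v i₀ : ℝ)| := by
      exact_mod_cast Int.le_of_dvd (abs_pos.2 hi₀)
        ((dvd_abs _ _).2 (Finset.gcd_dvd (Finset.mem_univ i₀)))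
    rw [hd] at h2
    exact_mod_cast h2.trans h1
  · simp only [hvi, mul_pow, ← Finset.mul_sum] at hv
    rw [div_pow, le_div_iff₀ (by positivity)]
    linarith
  · funext i
    rw [hv' i, hd]

theorem sum_Icc_two_one_div_pow_four_le (m : ℕ) :
    ∑ d ∈ Finset.Icc 2 m, 1 / (d : ℝ) ^ 4 ≤ 0.083 := by
  have h1 := sum_le_hasSum (insert 1 (Finset.Icc 2 m)) (fun d _ => by positivity) hasSum_zeta_four
  rw [Finset.sum_insert (by simp)] at h1
  have h2 : Real.pi ^ 4 ≤ 3.1416 ^ 4 := pow_le_pow_left₀ Real.pi_pos.le Real.pi_lt_d4.le 4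
  norm_num at h1 h2 ⊢
  linarith

theorem add_pow_four_le {a x : ℝ} (ha : 0 ≤ a) (hx : 0 ≤ x) :
    (a + x) ^ 4 ≤ 1.005 * a ^ 4 + 1001 ^ 4 * x ^ 4 := by
  by_cases h : 1000 * x ≤ a
  · have h1 : (a + x) ^ 4 ≤ (1.001 * a) ^ 4 := pow_le_pow_left₀ (by positivity) (by linarith) 4
    rw [mul_pow] at h1
    have h2 : 0 ≤ a ^ 4 := by positivity
    have h3 : 0 ≤ x ^ 4 := by positivity
    norm_num at h1 ⊢
    linarith
  · have h1 : (a + x) ^ 4 ≤ (1001 * x) ^ 4 := pow_le_pow_left₀ (by positivity) (by linarith) 4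
    rw [mul_pow] at h1
    have h2 : 0 ≤ a ^ 4 := by positivity
    linarith

theorem card_ballZ_div_le {n : ℕ} (hn : 2 ≤ n) {H : ℝ} (hH : (n : ℝ) ^ 30 ≤ H) {d : ℝ}
    (hd : 2 ≤ d) :
    ((ballZ (Fin n × Fin n) ((H / d) ^ 2)).card : ℝ) ≤ ((ballZ (Fin n × Fin n) (H ^ 2)).card : ℝ) *
      (1.006 * (1 / d ^ 4) + 1002 ^ 4 * ((n : ℝ) ^ 2 / H) ^ 4) := by
  have hn2 : (2 : ℝ) ≤ n := by exact_mod_cast hn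
  have hn0 : (0 : ℝ) < n := by linarith
  have hd0 : 0 < d := by linarith
  have hH0 : 0 < H := lt_of_lt_of_le (by positivity) hH
  have hcard : Fintype.card (Fin n × Fin n) = n ^ 2 := by simp [sq]
  have hN : (((n ^ 2 : ℕ) : ℕ) : ℝ) < H := by
    push_cast
    exact lt_of_lt_of_le (pow_lt_pow_right₀ (by linarith) (by norm_num)) hH
  have h2 := card_ballZ_mul_le (Fin n × Fin n) (R' := H / d) (R := H) (by positivity)
    (by rw [hcard]; exact hN)
  rw [hcard] at h2
  have h3 := one_sub_le_pow_of_pow_le hn hH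
  have hx : (n : ℝ) ^ 2 / H ≤ 1 / 2 := by
    rw [div_le_div_iff₀ hH0 (by norm_num), one_mul]
    calc (n : ℝ) ^ 2 * 2 ≤ (n : ℝ) ^ 2 * n := by gcongr
      _ = (n : ℝ) ^ 3 := by ring
      _ ≤ (n : ℝ) ^ 30 := pow_le_pow_right₀ (by linarith) (by norm_num)
      _ ≤ H := hH
  have hd2 : 1 / d ≤ 1 / 2 := one_div_le_one_div_of_le (by norm_num) hd
  have h4 : (H / d + (n ^ 2 : ℕ)) ^ (n ^ 2) ≤
      H ^ (n ^ 2) * (1.005 * (1 / d ^ 4) + 1001 ^ 4 * ((n : ℝ) ^ 2 / H) ^ 4) := by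
    have h5 : H / d + (n ^ 2 : ℕ) = H * (1 / d + (n : ℝ) ^ 2 / H) := by
      push_cast; field_simp
    rw [h5, mul_pow]
    refine mul_le_mul_of_nonneg_left ?_ (by positivity)
    calc (1 / d + (n : ℝ) ^ 2 / H) ^ (n ^ 2) ≤ (1 / d + (n : ℝ) ^ 2 / H) ^ 4 :=
          pow_le_pow_of_le_one (by positivity) (by linarith) (by nlinarith)
      _ ≤ 1.005 * (1 / d) ^ 4 + 1001 ^ 4 * ((n : ℝ) ^ 2 / H) ^ 4 :=
          add_pow_four_le (by positivity) (by positivity)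
      _ = _ := by rw [one_div_pow]
  set a := ((ballZ (Fin n × Fin n) ((H / d) ^ 2)).card : ℝ)
  set b := ((ballZ (Fin n × Fin n) (H ^ 2)).card : ℝ)
  have ha : 0 ≤ a := Nat.cast_nonneg _
  have hb : 0 ≤ b := Nat.cast_nonneg _
  set X := 1 / d ^ 4
  set Z := ((n : ℝ) ^ 2 / H) ^ 4
  have hX : 0 ≤ X := by positivity
  have hZ : 0 ≤ Z := by positivity
  have h5 : a * (0.9999 * H ^ (n ^ 2)) ≤ b * (H ^ (n ^ 2) * (1.005 * X + 1001 ^ 4 * Z)) :=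
    (mul_le_mul_of_nonneg_left h3 ha).trans (h2.trans (mul_le_mul_of_nonneg_left h4 hb))
  have h6 : 0.9999 * a ≤ b * (1.005 * X + 1001 ^ 4 * Z) := by
    refine le_of_mul_le_mul_right ?_ (show 0 < H ^ (n ^ 2) by positivity)
    linarith
  have h7 : 0 ≤ b * X := by positivity
  have h8 : 0 ≤ b * Z := by positivity
  norm_num at h6 ⊢
  linarith

open scoped Classical in
/-- At most a tenth of the integer matrices in a large ball fail to be primitive. -/
theorem card_nonprimitive_le {n : ℕ} (hn : 2 ≤ n) {H : ℝ} (hH : (n : ℝ) ^ 30 ≤ H) :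
    (((ballZ (Fin n × Fin n) (H ^ 2)).filter fun v => Finset.univ.gcd v ≠ 1).card : ℝ) ≤
      0.09 * ((ballZ (Fin n × Fin n) (H ^ 2)).card : ℝ) := by
  have hn2 : (2 : ℝ) ≤ n := by exact_mod_cast hn
  have hn0 : (0 : ℝ) < n := by linarith
  have hH0 : 0 < H := lt_of_lt_of_le (by positivity) hH
  set b := ((ballZ (Fin n × Fin n) (H ^ 2)).card : ℝ) with hb
  have hb0 : 0 ≤ b := Nat.cast_nonneg _
  have hb1 : (2 : ℝ) ^ 29 ≤ b := by
    have h1 := pow_div_le_card_ballZ (by omega : 1 ≤ n) hH0.le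
    have h2 : (2 : ℝ) ^ 29 ≤ H / n := by
      rw [le_div_iff₀ hn0]
      calc (2 : ℝ) ^ 29 * n ≤ (n : ℝ) ^ 29 * n := by gcongr
        _ = (n : ℝ) ^ 30 := by ring
        _ ≤ H := hH
    exact h2.trans ((le_self_pow₀ (le_trans (by norm_num) h2) (by positivity)).trans h1)
  have hsub : ((ballZ (Fin n × Fin n) (H ^ 2)).filter fun v => Finset.univ.gcd v ≠ 1) ⊆
      insert 0 ((Finset.Icc 2 ⌊H⌋₊).biUnion fun d =>
        (ballZ (Fin n × Fin n) ((H / d) ^ 2)).image fun v' i => (d : ℤ) * v' i) := by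
    intro v hv
    obtain ⟨hv1, hv2⟩ := Finset.mem_filter.1 hv
    by_cases hv0 : v = 0
    · exact Finset.mem_insert.2 (Or.inl hv0)
    · obtain ⟨d, hd, v', hv', rfl⟩ := gcd_ne_one_subset hH0.le (mem_ballZ.1 hv1) hv0 hv2
      exact Finset.mem_insert_of_mem (Finset.mem_biUnion.2
        ⟨d, hd, Finset.mem_image.2 ⟨v', hv', rfl⟩⟩)
  have h1 : (((ballZ (Fin n × Fin n) (H ^ 2)).filter fun v => Finset.univ.gcd v ≠ 1).card : ℝ) ≤
      ∑ d ∈ Finset.Icc 2 ⌊H⌋₊, ((ballZ (Fin n × Fin n) ((H / d) ^ 2)).card : ℝ) + 1 := by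
    have := (Finset.card_le_card hsub).trans ((Finset.card_insert_le _ _).trans
      (Nat.add_le_add_right (Finset.card_biUnion_le.trans
        (Finset.sum_le_sum fun d _ => Finset.card_image_le)) 1))
    exact_mod_cast this
  have h2 : ∑ d ∈ Finset.Icc 2 ⌊H⌋₊, ((ballZ (Fin n × Fin n) ((H / d) ^ 2)).card : ℝ) ≤
      b * (1.006 * ∑ d ∈ Finset.Icc 2 ⌊H⌋₊, 1 / (d : ℝ) ^ 4 +
        H * (1002 ^ 4 * ((n : ℝ) ^ 2 / H) ^ 4)) := by
    calc _ ≤ ∑ d ∈ Finset.Icc 2 ⌊H⌋₊,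
          b * (1.006 * (1 / (d : ℝ) ^ 4) + 1002 ^ 4 * ((n : ℝ) ^ 2 / H) ^ 4) :=
          Finset.sum_le_sum fun d hd => card_ballZ_div_le hn hH
            (by exact_mod_cast (Finset.mem_Icc.1 hd).1)
      _ = b * (1.006 * ∑ d ∈ Finset.Icc 2 ⌊H⌋₊, 1 / (d : ℝ) ^ 4 +
          (Finset.Icc 2 ⌊H⌋₊).card * (1002 ^ 4 * ((n : ℝ) ^ 2 / H) ^ 4)) := by
          rw [← Finset.mul_sum, Finset.sum_add_distrib, ← Finset.mul_sum, Finset.sum_const,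
            nsmul_eq_mul]
      _ ≤ _ := by
          gcongr
          rw [Nat.card_Icc]
          refine le_trans ?_ (Nat.floor_le hH0.le)
          exact_mod_cast (by omega : ⌊H⌋₊ + 1 - 2 ≤ ⌊H⌋₊)
  have h3 := sum_Icc_two_one_div_pow_four_le ⌊H⌋₊
  have h4 : H * (1002 ^ 4 * ((n : ℝ) ^ 2 / H) ^ 4) ≤ 0.001 := by
    have h5 : H * (1002 ^ 4 * ((n : ℝ) ^ 2 / H) ^ 4) = 1002 ^ 4 * (n : ℝ) ^ 8 / H ^ 3 := by
      field_simp
    rw [h5, div_le_iff₀ (by positivity)]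
    have h6 : ((n : ℝ) ^ 30) ^ 3 ≤ H ^ 3 := pow_le_pow_left₀ (by positivity) hH 3
    have h7 : (2 : ℝ) ^ 82 * (n : ℝ) ^ 8 ≤ ((n : ℝ) ^ 30) ^ 3 := by
      rw [show ((n : ℝ) ^ 30) ^ 3 = (n : ℝ) ^ 82 * (n : ℝ) ^ 8 by ring]
      gcongr
    have h8 : 0 ≤ (n : ℝ) ^ 8 := by positivity
    norm_num at h7 ⊢
    linarith
  have h5 : b * (1.006 * ∑ d ∈ Finset.Icc 2 ⌊H⌋₊, 1 / (d : ℝ) ^ 4 +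
        H * (1002 ^ 4 * ((n : ℝ) ^ 2 / H) ^ 4)) ≤ b * (1.006 * 0.083 + 0.001) := by gcongr
  refine h1.trans ((add_le_add_left (h2.trans h5) 1).trans ?_)
  norm_num at hb1 ⊢
  linarith

theorem log_le_mul_log_of_le_two_pow {n : ℕ} (hn : 2 ≤ n) {x : ℝ} (hx : 0 < x) (k : ℕ)
    (h : x ≤ 2 ^ k) : Real.log x ≤ k * Real.log n := by
  calc Real.log x ≤ Real.log (2 ^ k) := Real.log_le_log hx h
    _ = k * Real.log 2 := Real.log_pow _ _
    _ ≤ k * Real.log n := by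
      gcongr
      exact_mod_cast hn

/-- The logarithmic form of the lower bound on the height. -/
theorem log_weight_le {n : ℕ} (hn : 2 ≤ n) {a b : ℝ} (hb : 0 < b)
    (hab : Real.log 2 * (10 * (n : ℝ) ^ 4 * Real.log n + b) ≤ a) :
    0 < Real.log n ∧ 110 * Real.log n ≤ a ∧ b + 10 * (n : ℝ) ^ 4 * Real.log n ≤ 1.4429 * a := by
  have hl : 0 < Real.log n := Real.log_pos (by exact_mod_cast hn)
  have h2 := Real.log_two_gt_d9
  have hn4 : (16 : ℝ) ≤ (n : ℝ) ^ 4 := by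
    have : (2 : ℝ) ^ 4 ≤ (n : ℝ) ^ 4 := pow_le_pow_left₀ (by norm_num) (by exact_mod_cast hn) 4
    linarith
  have h3 : 0 < 10 * (n : ℝ) ^ 4 * Real.log n := by positivity
  have h4 : 0.6931 * (10 * (n : ℝ) ^ 4 * Real.log n + b) ≤ a :=
    le_trans (mul_le_mul_of_nonneg_right (by linarith) (by linarith)) hab
  have h5 : 16 * Real.log n ≤ (n : ℝ) ^ 4 * Real.log n := mul_le_mul_of_nonneg_right hn4 hl.le
  refine ⟨hl, ?_, ?_⟩ <;> linarith

theorem pow_le_of_mul_log_le {n : ℕ} (hn : 2 ≤ n) {H : ℝ} (hH : 0 < H) (k : ℕ)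
    (h : k * Real.log n ≤ Real.log H) : (n : ℝ) ^ k ≤ H := by
  have hn0 : (0 : ℝ) < n := by exact_mod_cast (by omega : 0 < n)
  rwa [← Real.log_le_log_iff (by positivity) hH, Real.log_pow]

theorem exceptional_log_cost_le {n a b l x y z u v : ℝ} (hn : 2 ≤ n) (hl : 0 < l) (hb : 0 < b)
    (hab : b + 10 * n ^ 4 * l ≤ 1.4429 * a) (hx : x ≤ 7 * l) (hy : y ≤ 7 * l) (hz : z ≤ 7 * l)
    (hu : u ≤ 2 * l) (hv : v ≤ 1 * l) (ha : 0 < a) :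
    x + b + n * (y + 38 * l + (v + 13 * l + (b - a) / 2) + (n - 1) * (u + a) + (z + a / 40)) ≤
      n ^ 2 * (a - l) := by
  have hinner : y + 38 * l + (v + 13 * l + (b - a) / 2) + (n - 1) * (u + a) + (z + a / 40) ≤
      64 * l + 2 * n * l + (b - a) / 2 + (n - 1) * a + a / 40 := by
    have := mul_le_mul_of_nonneg_left hu (by linarith : 0 ≤ n - 1)
    linarith
  have hmul := mul_le_mul_of_nonneg_left hinner (by linarith : 0 ≤ n)
  have hab' := mul_le_mul_of_nonneg_left hab (by linarith : 0 ≤ n)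
  have hnb := mul_le_mul_of_nonneg_right hn hb.le
  have hpoly : 7 + 64 * n + 3 * n ^ 2 ≤ n * (10 * n ^ 4) := by
    have h3 : (2 : ℝ) ^ 3 ≤ n ^ 3 := pow_le_pow_left₀ (by norm_num) hn 3
    have h4 : (2 : ℝ) ^ 4 ≤ n ^ 4 := pow_le_pow_left₀ (by norm_num) hn 4
    have h5 := mul_le_mul_of_nonneg_left h4 (by linarith : 0 ≤ n)
    have h6 := mul_le_mul_of_nonneg_left h3 (sq_nonneg n)
    linarith
  have hl' := mul_le_mul_of_nonneg_left hpoly hl.le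
  have hfin : 0 ≤ n * a := by positivity
  linarith

section Parameters

variable {n : ℕ} {H w ρ : ℝ}

theorem widening_cost_le (hn : 2 ≤ n) (hw : 1 < w) (hH : 0 < H)
    (hab : Real.log 2 * (10 * (n : ℝ) ^ 4 * Real.log n + Real.log w) ≤ Real.log H)
    (hρ : 0 < ρ) (hρlog : Real.log ρ =
      Real.log 2 + 13 * Real.log n + (Real.log w - Real.log H) / 2) :
    800 * (n : ℝ) ^ 62 * ρ ≤ H / (w * (n : ℝ) ^ 2) * H := by
  have hn0 : (0 : ℝ) < n := by exact_mod_cast (by omega : 0 < n)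
  have hw0 : 0 < w := by linarith
  have hb := Real.log_pos hw
  obtain ⟨hl, h1, h2⟩ := log_weight_le hn hb hab
  have hn4 : 16 * Real.log n ≤ (n : ℝ) ^ 4 * Real.log n := by
    have : (2 : ℝ) ^ 4 ≤ (n : ℝ) ^ 4 := pow_le_pow_left₀ (by norm_num) (by exact_mod_cast hn) 4
    exact mul_le_mul_of_nonneg_right (by linarith) hl.le
  have h800 := log_le_mul_log_of_le_two_pow hn (x := 800) (by norm_num) 10 (by norm_num)
  have hlog2 := log_le_mul_log_of_le_two_pow hn (x := 2) (by norm_num) 1 (by norm_num)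
  rw [← Real.log_le_log_iff (by positivity) (by positivity), Real.log_mul (by positivity) hρ.ne',
    Real.log_mul (by norm_num) (by positivity), Real.log_pow, Real.log_mul (by positivity) hH.ne',
    Real.log_div hH.ne' (by positivity), Real.log_mul hw0.ne' (by positivity), Real.log_pow, hρlog]
  push_cast at *
  linarith

theorem unimodular_bound_le (hn : 2 ≤ n) (hw : 1 < w) (hH : 0 < H)
    (hab : Real.log 2 * (10 * (n : ℝ) ^ 4 * Real.log n + Real.log w) ≤ Real.log H) :
    10 * (n : ℝ) ^ 24 / (H / (w * (n : ℝ) ^ 2)) ≤ H := by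
  have hn0 : (0 : ℝ) < n := by exact_mod_cast (by omega : 0 < n)
  have hw0 : 0 < w := by linarith
  have hb := Real.log_pos hw
  obtain ⟨hl, h1, h2⟩ := log_weight_le hn hb hab
  have hn4 : 16 * Real.log n ≤ (n : ℝ) ^ 4 * Real.log n := by
    have : (2 : ℝ) ^ 4 ≤ (n : ℝ) ^ 4 := pow_le_pow_left₀ (by norm_num) (by exact_mod_cast hn) 4
    exact mul_le_mul_of_nonneg_right (by linarith) hl.le
  have h10 := log_le_mul_log_of_le_two_pow hn (x := 10) (by norm_num) 4 (by norm_num)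
  rw [← Real.log_le_log_iff (by positivity) (by positivity), Real.log_div (by positivity)
    (by positivity), Real.log_mul (by norm_num) (by positivity), Real.log_pow,
    Real.log_div hH.ne' (by positivity), Real.log_mul hw0.ne' (by positivity), Real.log_pow]
  push_cast at *
  linarith

theorem exceptional_cost_le (hn : 2 ≤ n) (hw : 1 < w) (hH : 0 < H)
    (hab : Real.log 2 * (10 * (n : ℝ) ^ 4 * Real.log n + Real.log w) ≤ Real.log H)
    (hρ : 0 < ρ) (hρ2 : 1 ≤ 4 * ρ ^ 2) (hρlog : Real.log ρ =
      Real.log 2 + 13 * Real.log n + (Real.log w - Real.log H) / 2) {Y : ℝ} (hY : 1 ≤ Y)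
    (hYH : Y ≤ H) :
    100 * w * ((2 * (35 * (n : ℝ) ^ 38 * ρ) + 1) * (3 * H) ^ (n - 1) * (3 + 2 * Real.log Y)) ^ n ≤
      (H / n) ^ (n ^ 2) := by
  have hn2 : (2 : ℝ) ≤ n := by exact_mod_cast hn
  have hn0 : (0 : ℝ) < n := by linarith
  have hw0 : 0 < w := by linarith
  have hb := Real.log_pos hw
  obtain ⟨hl, h1, h2⟩ := log_weight_le hn hb hab
  set a := Real.log H with ha
  set b := Real.log w with hbdef
  set l := Real.log n with hldef
  have h100 := log_le_mul_log_of_le_two_pow hn (x := 100) (by norm_num) 7 (by norm_num)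
  have h71 := log_le_mul_log_of_le_two_pow hn (x := 71) (by norm_num) 7 (by norm_num)
  have h83 := log_le_mul_log_of_le_two_pow hn (x := 83) (by norm_num) 7 (by norm_num)
  have h3 := log_le_mul_log_of_le_two_pow hn (x := 3) (by norm_num) 2 (by norm_num)
  have hlog2 := log_le_mul_log_of_le_two_pow hn (x := 2) (by norm_num) 1 (by norm_num)
  have ha0 : 0 < a := by linarith
  have hlogY : 0 ≤ Real.log Y := Real.log_nonneg hY
  have hlogYa : Real.log Y ≤ a := Real.log_le_log (by linarith) hYH
  have hT : 2 * (35 * (n : ℝ) ^ 38 * ρ) + 1 ≤ 71 * (n : ℝ) ^ 38 * ρ := by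
    have hρ1 : 1 ≤ 2 * ρ := by nlinarith
    have hn38 : (n : ℝ) ≤ (n : ℝ) ^ 38 := le_self_pow₀ (by linarith) (by norm_num)
    nlinarith
  have hL : 3 + 2 * Real.log Y ≤ 83 * Real.exp (a / 40) := by
    have := Real.add_one_le_exp (a / 40)
    linarith
  have hB : 100 * w * ((2 * (35 * (n : ℝ) ^ 38 * ρ) + 1) * (3 * H) ^ (n - 1) *
      (3 + 2 * Real.log Y)) ^ n ≤ 100 * w * ((71 * (n : ℝ) ^ 38 * ρ) * (3 * H) ^ (n - 1) *
      (83 * Real.exp (a / 40))) ^ n := by gcongr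
  refine hB.trans ?_
  have hlogs : Real.log (100 * w * ((71 * (n : ℝ) ^ 38 * ρ) * (3 * H) ^ (n - 1) *
      (83 * Real.exp (a / 40))) ^ n) = Real.log 100 + b + n * (Real.log 71 + 38 * l +
        Real.log ρ + (n - 1) * (Real.log 3 + a) + (Real.log 83 + a / 40)) := by
    rw [Real.log_mul (by positivity) (by positivity), Real.log_mul (by norm_num) hw0.ne',
      Real.log_pow, Real.log_mul (by positivity) (by positivity),
      Real.log_mul (by positivity) (by positivity), Real.log_mul (by positivity) hρ.ne',
      Real.log_mul (by norm_num) (by positivity), Real.log_pow, Real.log_pow,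
      Real.log_mul (by norm_num) hH.ne', Real.log_mul (by norm_num) (by positivity), Real.log_exp,
      Nat.cast_sub (by omega)]
    push_cast
    ring
  rw [← Real.log_le_log_iff (by positivity) (by positivity), hlogs, Real.log_pow,
    Real.log_div hH.ne' hn0.ne', hρlog]
  push_cast at h100 h71 h83 h3 hlog2 ⊢
  exact exceptional_log_cost_le hn2 hl hb h2 h100 h71 h83 h3 hlog2 ha0

end Parameters

section NearRow

variable {n : ℕ} {H w : ℝ}

theorem two_add_pow_le_mul_two_sub_pow {e : ℝ} (he : 0 ≤ e) (he' : e ≤ 1 / 4096) :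
    1.67 * (2 + e) ^ 3 ≤ 1.68 * (2 - e) ^ 3 := by
  have h1 : (2 + e) ^ 3 ≤ (2 + 1 / 4096) ^ 3 := by gcongr
  have h2 : (2 - 1 / 4096) ^ 3 ≤ (2 - e) ^ 3 := by gcongr
  norm_num at h1 h2 ⊢
  linarith

open scoped Classical in
/-- Few integer matrices of bounded Frobenius norm have all rows close to a common hyperplane
whose normal is a small unimodular integer vector. -/
theorem card_unimodular_near_le (hn : 2 ≤ n) (hw : 1 < w) (hH : 0 < H)
    (hab : Real.log 2 * (10 * (n : ℝ) ^ 4 * Real.log n + Real.log w) ≤ Real.log H) {δ ρ : ℝ}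
    (hδ : δ = H / (w * (n : ℝ) ^ 2)) (hρ : 0 < ρ) (hρδ : ρ ^ 2 * δ = 4 * (n : ℝ) ^ 24)
    (hρlog : Real.log ρ = Real.log 2 + 13 * Real.log n + (Real.log w - Real.log H) / 2) :
    100 * w * (((matBall n (H ^ 2)).filter fun X => ∃ y b : Fin n → ℤ, ∑ i, b i * y i = 1 ∧
      (∀ i, |(y i : ℝ)| ≤ 10 * (n : ℝ) ^ 24 / δ) ∧
      ∀ j, |((∑ i, X j i * y i : ℤ) : ℝ)| ≤ 35 * (n : ℝ) ^ 38 * ρ).card : ℝ) ≤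
      (matBall n (H ^ 2)).card := by
  set E := (matBall n (H ^ 2)).filter fun X => ∃ y b : Fin n → ℤ, ∑ i, b i * y i = 1 ∧
      (∀ i, |(y i : ℝ)| ≤ 10 * (n : ℝ) ^ 24 / δ) ∧
      ∀ j, |((∑ i, X j i * y i : ℤ) : ℝ)| ≤ 35 * (n : ℝ) ^ 38 * ρ with hE
  have hn0 : (0 : ℝ) < n := by exact_mod_cast (by omega : 0 < n)
  have hw0 : 0 < w := by linarith
  have hδ0 : 0 < δ := by rw [hδ]; positivity
  rcases E.eq_empty_or_nonempty with hE0 | ⟨X, hX⟩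
  · simp [hE0]
  have hY : 1 ≤ 10 * (n : ℝ) ^ 24 / δ := by
    obtain ⟨-, y, b, hby, hy, -⟩ := Finset.mem_filter.1 hX
    obtain ⟨i, hi⟩ : ∃ i, y i ≠ 0 := by
      by_contra! hy0
      simp [hy0] at hby
    refine le_trans ?_ (hy i)
    exact_mod_cast Int.one_le_abs hi
  have hYH : 10 * (n : ℝ) ^ 24 / δ ≤ H := by
    rw [hδ]; exact unimodular_bound_le hn hw hH hab
  have hρ2 : 1 ≤ 4 * ρ ^ 2 := by
    have : 4 * ρ ^ 2 = 1.6 * (10 * (n : ℝ) ^ 24 / δ) := by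
      field_simp
      linarith
    linarith
  have hcard := card_rows_near_hyperplane_le (by positivity : 0 ≤ 35 * (n : ℝ) ^ 38 * ρ) hY hYH E
    (fun X hX => by
      obtain ⟨hXb, y, b, hby, hy, hxy⟩ := Finset.mem_filter.1 hX
      refine ⟨fun j i => ?_, y, b, hby, hy, hxy⟩
      refine abs_le_of_sq_le_sq ?_ hH.le
      refine le_trans ?_ (mem_matBall.1 hXb)
      exact (Finset.single_le_sum (f := fun k => (X j k : ℝ) ^ 2) (fun k _ => sq_nonneg _)
        (Finset.mem_univ i)).trans (Finset.single_le_sum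
          (f := fun j => ∑ k, (X j k : ℝ) ^ 2) (fun j _ => Finset.sum_nonneg fun k _ => sq_nonneg _)
          (Finset.mem_univ j)))
  calc 100 * w * (E.card : ℝ) ≤ _ := mul_le_mul_of_nonneg_left hcard (by positivity)
    _ ≤ (H / n) ^ (n ^ 2) := exceptional_cost_le hn hw hH hab hρ hρ2 hρlog hY hYH
    _ ≤ _ := by
      rw [card_matBall]
      exact pow_div_le_card_ballZ (by omega) hH.le

open scoped Classical in
/-- Integer matrices of bounded Frobenius norm with some row close to the span of the other rows
are rare. -/
theorem card_exists_row_near_le (hn : 2 ≤ n) (hw : 1 < w) (hH : 0 < H)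
    (hab : Real.log 2 * (10 * (n : ℝ) ^ 4 * Real.log n + Real.log w) ≤ Real.log H)
    (u : Fin n → (Fin n → Fin n → ℤ) → Fin n → ℝ) (hu : ∀ j C, ∑ k, u j C k ^ 2 = 1)
    (hperp : ∀ j C i, i ≠ j → ∑ k, u j C k * (C i k : ℝ) = 0) :
    w * (((matBall n (H ^ 2)).filter fun X => ∃ j,
      |pairing (u j (Function.update X j 0)) (X j)| ≤ H / (w * (n : ℝ) ^ 2)).card : ℝ) ≤
      1.7 * (matBall n (H ^ 2)).card := by
  have hn2 : (2 : ℝ) ≤ n := by exact_mod_cast hn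
  have hn0 : (0 : ℝ) < n := by linarith
  have hw0 : 0 < w := by linarith
  obtain ⟨hl, hl110, -⟩ := log_weight_le hn (Real.log_pos hw) hab
  have hHpow (k : ℕ) (hk : k ≤ 110) : (n : ℝ) ^ k ≤ H := by
    refine pow_le_of_mul_log_le hn hH k (le_trans ?_ hl110)
    gcongr
    exact_mod_cast hk
  set δ := H / (w * (n : ℝ) ^ 2) with hδ
  set e := 1 / (n : ℝ) ^ 12 with he
  set ρ := 2 * (n : ℝ) ^ 13 * Real.sqrt (w / H) with hρ
  set N : ℝ := ((matBall n (H ^ 2)).card : ℝ) with hN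
  have hδ0 : 0 < δ := by positivity
  have hρ0 : 0 < ρ := by positivity
  have hρδ : ρ ^ 2 * δ = 4 * (n : ℝ) ^ 24 := by
    rw [hρ, mul_pow, Real.sq_sqrt (by positivity), hδ]
    field_simp
    norm_num
  have hρlog : Real.log ρ = Real.log 2 + 13 * Real.log n + (Real.log w - Real.log H) / 2 := by
    rw [hρ, Real.log_mul (by positivity) (by positivity), Real.log_mul (by norm_num)
      (by positivity), Real.log_pow, Real.log_sqrt (by positivity),
      Real.log_div hw0.ne' hH.ne']
    norm_num
  have hδH : δ ≤ H / n := by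
    rw [hδ]
    gcongr
    nlinarith
  have hH25 : 4 * (n : ℝ) ^ 25 ≤ H := by
    refine le_trans ?_ (hHpow 27 (by norm_num))
    have : (2 : ℝ) ^ 2 ≤ (n : ℝ) ^ 2 := by gcongr
    calc 4 * (n : ℝ) ^ 25 ≤ (n : ℝ) ^ 2 * (n : ℝ) ^ 25 := by gcongr; linarith
      _ = _ := by ring
  have hK : 800 * (n : ℝ) ^ 62 * ρ ≤ δ * H := widening_cost_le hn hw hH hab hρ0 hρlog
  have he0 : 0 < e := by positivity
  have he1 : e ≤ 1 / 4096 := by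
    rw [he]
    have : (2 : ℝ) ^ 12 ≤ (n : ℝ) ^ 12 := by gcongr
    gcongr
    linarith
  set exc : Fin n → (Fin n → Fin n → ℤ) → Prop := fun j C =>
    ∃ y b : Fin n → ℤ, ∑ i, b i * y i = 1 ∧ (∀ i, |(y i : ℝ)| ≤ 10 * (n : ℝ) ^ 24 / δ) ∧
      ∀ x ∈ slabZ (u j C) δ (H ^ 2), |((∑ i, x i * y i : ℤ) : ℝ)| ≤ 35 * (n : ℝ) ^ 38 * ρ
      with hexc
  set E := (matBall n (H ^ 2)).filter fun X => ∃ y b : Fin n → ℤ, ∑ i, b i * y i = 1 ∧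
      (∀ i, |(y i : ℝ)| ≤ 10 * (n : ℝ) ^ 24 / δ) ∧
      ∀ j, |((∑ i, X j i * y i : ℤ) : ℝ)| ≤ 35 * (n : ℝ) ^ 38 * ρ with hE
  have hEcard : 100 * w * (E.card : ℝ) ≤ N :=
    card_unimodular_near_le hn hw hH hab hδ hρ0 hρδ hρlog
  set G : Fin n → Finset (Fin n → Fin n → ℤ) := fun j => (matBall n (H ^ 2)).filter fun X =>
    ¬ exc j (Function.update X j 0) ∧ |pairing (u j (Function.update X j 0)) (X j)| ≤ δ with hG
  have hGcard (j : Fin n) : w * ((G j).card : ℝ) ≤ 1.68 * N / n := by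
    have h1 := card_matrices_row_slab_le j (u j) (fun C => ¬ exc j C)
      (α := (2 - e) ^ 3 * (H / n)) (β := (2 + e) ^ 3 * δ) (δ := δ)
      (κ := H ^ 2 * (1 / (n : ℝ) ^ 2 + 15 * e)) hH.le
      (mul_nonneg (pow_nonneg (by linarith) 3) (by positivity)) (by positivity)
      (fun C hC => (card_slab_le_or_unimodular hn (hu j C) he hδ0 hδH hH25 hρ0.le hρδ
        hK).resolve_left hC)
    have h2 := card_ballZ_inflate_le hn (hHpow 30 (by norm_num))
    rw [← card_matBall, ← card_matBall] at h2
    have h3 := h1.trans (mul_le_mul_of_nonneg_left h2 (by positivity))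
    have h4 : (2 - e) ^ 3 * (w * ((G j).card : ℝ)) ≤ (2 + e) ^ 3 * (1.67 * N / n) := by
      have h5 : (2 - e) ^ 3 * (H / n) * ((G j).card : ℝ) ≤ (2 + e) ^ 3 * δ * (1.67 * N) := by
        refine le_of_eq_of_le ?_ h3
        simp only [hG]
        congr!
      rw [hδ] at h5
      field_simp at h5 ⊢
      linarith
    have hpos : 0 < (2 - e) ^ 3 := pow_pos (by linarith) 3
    refine le_of_mul_le_mul_left (h4.trans ?_) hpos
    have h6 := mul_le_mul_of_nonneg_right (two_add_pow_le_mul_two_sub_pow he0.le he1)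
      (by positivity : 0 ≤ N / n)
    calc _ = 1.67 * (2 + e) ^ 3 * (N / n) := by ring
      _ ≤ _ := h6
      _ = _ := by ring
  have hsub : ((matBall n (H ^ 2)).filter fun X => ∃ j,
      |pairing (u j (Function.update X j 0)) (X j)| ≤ δ) ⊆ E ∪ Finset.univ.biUnion G := by
    intro X hX
    obtain ⟨hXb, j, hj⟩ := Finset.mem_filter.1 hX
    by_cases hx : exc j (Function.update X j 0)
    · refine Finset.mem_union_left _ (Finset.mem_filter.2 ⟨hXb, ?_⟩)
      obtain ⟨y, b, hby, hy, hs⟩ := hx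
      refine ⟨y, b, hby, hy, fun i => hs _ (mem_slabZ.2 ⟨?_, ?_⟩)⟩
      · exact (Finset.single_le_sum (f := fun j => ∑ k, (X j k : ℝ) ^ 2)
          (fun j _ => Finset.sum_nonneg fun k _ => sq_nonneg _)
          (Finset.mem_univ i)).trans (mem_matBall.1 hXb)
      · by_cases hij : i = j
        · exact hij ▸ hj
        · have := hperp j (Function.update X j 0) i hij
          rw [Function.update_of_ne hij] at this
          rw [pairing_apply, this, abs_zero]
          exact hδ0.le
    · exact Finset.mem_union_right _ (Finset.mem_biUnion.2
        ⟨j, Finset.mem_univ j, Finset.mem_filter.2 ⟨hXb, hx, hj⟩⟩)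
  have hcard : (((matBall n (H ^ 2)).filter fun X => ∃ j,
      |pairing (u j (Function.update X j 0)) (X j)| ≤ δ).card : ℝ) ≤
      E.card + ∑ j, ((G j).card : ℝ) := by
    exact_mod_cast (Finset.card_le_card hsub).trans ((Finset.card_union_le _ _).trans
      (Nat.add_le_add_left Finset.card_biUnion_le _))
  have hsum : w * ∑ j, ((G j).card : ℝ) ≤ 1.68 * N := by
    rw [Finset.mul_sum]
    refine (Finset.sum_le_sum fun j _ => hGcard j).trans ?_
    rw [Finset.sum_const, Finset.card_univ, Fintype.card_fin, nsmul_eq_mul, mul_div_cancel₀]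
    exact hn0.ne'
  have hN0 : 0 ≤ N := by positivity
  have := mul_le_mul_of_nonneg_left hcard hw0.le
  linarith

end NearRow

section Projective

variable {n : ℕ} {H w : ℝ}

theorem map_intCast_apply (A : Fin n → Fin n → ℤ) (i j : Fin n) :
    Matrix.map A (Int.cast : ℤ → ℚ) i j = (A i j : ℚ) :=
  rfl

/-- The entries of an integer matrix have greatest common divisor `1`. -/
def IsPrimitive (A : Fin n → Fin n → ℤ) : Prop :=
  Finset.univ.gcd (fun p : Fin n × Fin n => A p.1 p.2) = 1

theorem IsPrimitive.map_ne_zero {A : Fin n → Fin n → ℤ} (hA : IsPrimitive A) :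
    Matrix.map A (Int.cast : ℤ → ℚ) ≠ 0 := by
  intro h
  have h0 : Finset.univ.gcd (fun p : Fin n × Fin n => A p.1 p.2) = 0 := by
    rw [Finset.gcd_eq_zero_iff]
    intro p _
    have := congrFun (congrFun h p.1) p.2
    simpa [map_intCast_apply] using this
  rw [IsPrimitive, h0] at hA
  exact zero_ne_one hA

theorem IsPrimitive.neg {A : Fin n → Fin n → ℤ} (hA : IsPrimitive A) : IsPrimitive (-A) := by
  have h := Finset.gcd_mul_left (s := Finset.univ)
    (f := fun p : Fin n × Fin n => A p.1 p.2) (a := (-1 : ℤ))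
  rw [show Finset.univ.gcd (fun p : Fin n × Fin n => A p.1 p.2) = 1 from hA] at h
  rw [mul_one, ← Int.abs_eq_normalize] at h
  simpa [IsPrimitive] using h

/-- The projective class of a primitive integer matrix. -/
def IsPrimitive.proj {A : Fin n → Fin n → ℤ} (hA : IsPrimitive A) :
    Projectivization ℚ (Matrix (Fin n) (Fin n) ℚ) :=
  Projectivization.mk ℚ (Matrix.map A (Int.cast : ℤ → ℚ)) hA.map_ne_zero

theorem IsPrimitive.proj_neg {A : Fin n → Fin n → ℤ} (hA : IsPrimitive A) :
    hA.neg.proj = hA.proj := by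
  rw [IsPrimitive.proj, IsPrimitive.proj, Projectivization.mk_eq_mk_iff']
  refine ⟨-1, ?_⟩
  ext i j
  simp [map_intCast_apply]

theorem IsPrimitive.eq_or_eq_neg_of_proj_eq {A B : Fin n → Fin n → ℤ} (hA : IsPrimitive A)
    (hB : IsPrimitive B) (h : hA.proj = hB.proj) : A = B ∨ A = -B := by
  rw [IsPrimitive.proj, IsPrimitive.proj, Projectivization.mk_eq_mk_iff'] at h
  obtain ⟨c, hc⟩ := h
  have hentry (i j : Fin n) : (c.den : ℤ) * A i j = c.num * B i j := by
    have h1 : c * (B i j : ℚ) = A i j := by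
      simpa [map_intCast_apply] using congrFun (congrFun hc i) j
    have h2 : (c.den : ℚ) * A i j = c.num * B i j := by
      rw [← h1, ← mul_assoc, Rat.den_mul_eq_num]
    exact_mod_cast h2
  have hgcd : normalize (c.den : ℤ) = normalize c.num := by
    have h1 := Finset.gcd_mul_left (s := Finset.univ)
      (f := fun p : Fin n × Fin n => A p.1 p.2) (a := (c.den : ℤ))
    have h2 := Finset.gcd_mul_left (s := Finset.univ)
      (f := fun p : Fin n × Fin n => B p.1 p.2) (a := c.num)
    rw [show Finset.univ.gcd (fun p : Fin n × Fin n => A p.1 p.2) = 1 from hA, mul_one] at h1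
    rw [show Finset.univ.gcd (fun p : Fin n × Fin n => B p.1 p.2) = 1 from hB, mul_one] at h2
    rw [← h1, ← h2]
    exact congrArg _ (funext fun p => hentry p.1 p.2)
  have hden : (c.den : ℤ) ≠ 0 := by exact_mod_cast c.den_ne_zero
  rw [← Int.abs_eq_normalize, ← Int.abs_eq_normalize, abs_eq_abs] at hgcd
  rcases hgcd with h1 | h1
  · left
    ext i j
    have := hentry i j
    rw [← h1] at this
    exact mul_left_cancel₀ hden this
  · right
    ext i j
    have := hentry i j
    rw [h1, neg_mul] at this
    have h2 : c.num ≠ 0 := by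
      intro h0
      simp [h0] at h1
    refine mul_left_cancel₀ h2 ?_
    simp only [Pi.neg_apply, mul_neg]
    linarith

theorem IsPrimitive.exists_row_near (hn : 1 ≤ n) {A : Fin n → Fin n → ℤ} (hA : IsPrimitive A)
    (hw : 0 < w) (hk : ENNReal.ofReal (w * (n : ℝ) ^ ((5 : ℝ) / 2)) ≤ kP hA.proj)
    (u : Fin n → Fin n → ℝ) (hu : ∀ j, ∑ k, u j k ^ 2 = 1)
    (hperp : ∀ j i, i ≠ j → ∑ k, u j k * (A i k : ℝ) = 0) :
    ∃ j, |∑ k, u j k * (A j k : ℝ)| * (w * (n : ℝ) ^ 2) ≤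
      frobNorm (Matrix.map A (Int.cast : ℤ → ℝ)) := by
  obtain ⟨c, hc⟩ := Projectivization.exists_smul_eq_mk_rep ℚ
    (Matrix.map A (Int.cast : ℤ → ℚ)) hA.map_ne_zero
  have hc0 : 0 < |((c : ℚ) : ℝ)| := by
    rw [abs_pos]
    exact_mod_cast c.ne_zero
  have hrep (i j : Fin n) : ((hA.proj.rep).map (Rat.cast : ℚ → ℝ)) i j =
      ((c : ℚ) : ℝ) * (A i j : ℝ) := by
    rw [IsPrimitive.proj, ← hc]
    simp [Units.smul_def, map_intCast_apply]
  have hpair (j i : Fin n) : ∑ k, u j k * ((hA.proj.rep).map (Rat.cast : ℚ → ℝ)) i k =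
      ((c : ℚ) : ℝ) * ∑ k, u j k * (A i k : ℝ) := by
    rw [Finset.mul_sum]
    exact Finset.sum_congr rfl fun k _ => by rw [hrep]; ring
  obtain ⟨j, hj⟩ := exists_row_near_of_le_kE hn _ hw hk u hu
    (fun j i hij => by rw [hpair, hperp j i hij, mul_zero])
  refine ⟨j, ?_⟩
  have hfrob : frobNorm ((hA.proj.rep).map (Rat.cast : ℚ → ℝ)) =
      |((c : ℚ) : ℝ)| * frobNorm (Matrix.map A (Int.cast : ℤ → ℝ)) := by
    rw [frobNorm, frobNorm, ← Real.sqrt_sq_eq_abs, ← Real.sqrt_mul (sq_nonneg _), Finset.mul_sum]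
    congr 1
    refine Finset.sum_congr rfl fun i _ => ?_
    rw [Finset.mul_sum]
    exact Finset.sum_congr rfl fun k _ => by rw [hrep, mul_pow]; rfl
  rw [hpair, hfrob, abs_mul, mul_assoc] at hj
  exact le_of_mul_le_mul_left hj hc0

theorem frobNorm_le_iff_mem_matBall (hH : 0 ≤ H) {A : Fin n → Fin n → ℤ} :
    frobNorm (Matrix.map A (Int.cast : ℤ → ℝ)) ≤ H ↔ A ∈ matBall n (H ^ 2) := by
  rw [mem_matBall, frobNorm, Real.sqrt_le_iff]
  exact ⟨fun h => h.2, fun h => ⟨hH, h⟩⟩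

theorem heightLE_iff (hH : 0 ≤ H) {P : Projectivization ℚ (Matrix (Fin n) (Fin n) ℚ)} :
    heightLE P H ↔ ∃ A ∈ matBall n (H ^ 2), ∃ hA : IsPrimitive A, hA.proj = P := by
  constructor
  · rintro ⟨A, h0, hA, rfl, hAH⟩
    exact ⟨A, (frobNorm_le_iff_mem_matBall hH).1 hAH, hA, rfl⟩
  · rintro ⟨A, hAH, hA, rfl⟩
    exact ⟨A, hA.map_ne_zero, hA, rfl, (frobNorm_le_iff_mem_matBall hH).2 hAH⟩

open scoped Classical in
/-- Counting a set of rational projective points of bounded height through primitive integer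
matrices: each point has exactly two primitive representatives. -/
theorem two_mul_ncard_eq (hH : 0 ≤ H)
    (q : Projectivization ℚ (Matrix (Fin n) (Fin n) ℚ) → Prop) :
    2 * Set.ncard {P | heightLE P H ∧ q P} =
      ((matBall n (H ^ 2)).filter fun A => ∃ hA : IsPrimitive A, q hA.proj).card := by
  set S := (matBall n (H ^ 2)).filter fun A => ∃ hA : IsPrimitive A, q hA.proj with hS
  set f : {A // A ∈ S} → Projectivization ℚ (Matrix (Fin n) (Fin n) ℚ) :=
    fun A => (Finset.mem_filter.1 A.2).2.choose.proj with hf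
  have himage : {P | heightLE P H ∧ q P} = ↑(Finset.univ.image f) := by
    ext P
    simp only [Set.mem_ofPred_eq, Finset.coe_image, Finset.coe_univ, Set.image_univ,
      Set.mem_range, heightLE_iff hH]
    constructor
    · rintro ⟨⟨A, hAH, hA, rfl⟩, hq⟩
      exact ⟨⟨A, Finset.mem_filter.2 ⟨hAH, hA, hq⟩⟩, rfl⟩
    · rintro ⟨⟨A, hAS⟩, rfl⟩
      obtain ⟨hAH, hA⟩ := Finset.mem_filter.1 hAS
      exact ⟨⟨A, hAH, hA.choose, rfl⟩, hA.choose_spec⟩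
  have hneg (A : {A // A ∈ S}) : -A.1 ∈ S := by
    obtain ⟨hAH, hA, hq⟩ := Finset.mem_filter.1 A.2
    refine Finset.mem_filter.2 ⟨?_, hA.neg, hA.proj_neg ▸ hq⟩
    rw [mem_matBall] at hAH ⊢
    simpa using hAH
  have hfiber (A : {A // A ∈ S}) :
      (Finset.univ.filter fun B => f B = f A) = {A, ⟨-A.1, hneg A⟩} := by
    obtain ⟨hAH, hA, hq⟩ := Finset.mem_filter.1 A.2
    ext B
    obtain ⟨hBH, hB, hqB⟩ := Finset.mem_filter.1 B.2
    simp only [Finset.mem_filter, Finset.mem_univ, true_and, Finset.mem_insert,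
      Finset.mem_singleton, Subtype.ext_iff]
    constructor
    · exact fun h => hB.eq_or_eq_neg_of_proj_eq hA h
    · rintro (h | h)
      · exact congrArg f (Subtype.ext h)
      · rw [show B = ⟨-A.1, hneg A⟩ from Subtype.ext h]
        exact hA.proj_neg
  have hcard (A : {A // A ∈ S}) : (Finset.univ.filter fun B => f B = f A).card = 2 := by
    rw [hfiber, Finset.card_pair]
    intro h
    obtain ⟨-, hA, -⟩ := Finset.mem_filter.1 A.2
    refine hA.map_ne_zero ?_
    ext i j
    have h1 : A.1 i j = -A.1 i j := congrFun (congrFun (congrArg Subtype.val h) i) j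
    have h2 : A.1 i j = 0 := by omega
    simp [map_intCast_apply, h2]
  rw [himage, Set.ncard_coe_finset, ← Finset.card_attach (s := S), ← Finset.univ_eq_attach,
    Finset.card_eq_sum_card_image f, Finset.sum_const_nat (m := 2), mul_comm]
  intro P hP
  obtain ⟨A, -, rfl⟩ := Finset.mem_image.1 hP
  exact hcard A

end Projective

section Conclusion

variable {n : ℕ} {H w : ℝ}

open scoped Classical in
theorem le_card_isPrimitive (hn : 2 ≤ n) (hH : (n : ℝ) ^ 30 ≤ H) :
    0.91 * ((matBall n (H ^ 2)).card : ℝ) ≤ ((matBall n (H ^ 2)).filter IsPrimitive).card := by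
  have h1 := card_nonprimitive_le hn hH
  have h2 : ((matBall n (H ^ 2)).filter fun A => ¬ IsPrimitive A).card ≤
      ((ballZ (Fin n × Fin n) (H ^ 2)).filter fun v => Finset.univ.gcd v ≠ 1).card := by
    refine Finset.card_le_card_of_injOn Function.uncurry (fun A hA => ?_)
      Function.uncurry_injective.injOn
    obtain ⟨hAH, hA⟩ := Finset.mem_filter.1 hA
    refine Finset.mem_coe.2 (Finset.mem_filter.2 ⟨?_, hA⟩)
    rw [mem_ballZ, Fintype.sum_prod_type]
    exact mem_matBall.1 hAH
  have h3 : (((matBall n (H ^ 2)).filter IsPrimitive).card : ℝ) +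
      ((matBall n (H ^ 2)).filter fun A => ¬ IsPrimitive A).card = (matBall n (H ^ 2)).card := by
    exact_mod_cast Finset.card_filter_add_card_filter_not _
  have h4 : (((matBall n (H ^ 2)).filter fun A => ¬ IsPrimitive A).card : ℝ) ≤
      ((ballZ (Fin n × Fin n) (H ^ 2)).filter fun v => Finset.univ.gcd v ≠ 1).card := by
    exact_mod_cast h2
  rw [← card_matBall] at h1
  linarith

theorem mul_ncard_ill_conditioned_le (hn : 2 ≤ n) (hw : 1 < w) (hH : 0 < H)
    (hab : Real.log 2 * (10 * (n : ℝ) ^ 4 * Real.log n + Real.log w) ≤ Real.log H) :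
    w * (Set.ncard {P : Projectivization ℚ (Matrix (Fin n) (Fin n) ℚ) |
        heightLE P H ∧ ENNReal.ofReal (w * (n : ℝ) ^ ((5 : ℝ) / 2)) ≤ kP P} : ℝ) ≤
      2 * (Set.ncard {P : Projectivization ℚ (Matrix (Fin n) (Fin n) ℚ) | heightLE P H} : ℝ) := by
  classical
  have hn0 : (0 : ℝ) < n := by exact_mod_cast (by omega : 0 < n)
  have hw0 : 0 < w := by linarith
  have hH30 : (n : ℝ) ^ 30 ≤ H := by
    obtain ⟨hl, hl110, -⟩ := log_weight_le hn (Real.log_pos hw) hab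
    refine pow_le_of_mul_log_le hn hH 30 (le_trans ?_ hl110)
    gcongr
    norm_num
  choose u hu hperp using fun (j : Fin n) (C : Fin n → Fin n → ℤ) =>
    exists_unit_normal (fun i k => (C i k : ℝ)) j
  have hnear := card_exists_row_near_le hn hw hH hab u hu hperp
  have hbad := two_mul_ncard_eq (n := n) hH.le
    (fun P => ENNReal.ofReal (w * (n : ℝ) ^ ((5 : ℝ) / 2)) ≤ kP P)
  have hall := two_mul_ncard_eq (n := n) hH.le (fun _ => True)
  simp only [and_true, exists_prop] at hall
  have hprim := le_card_isPrimitive hn hH30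
  have hsub : 2 * Set.ncard {P : Projectivization ℚ (Matrix (Fin n) (Fin n) ℚ) |
        heightLE P H ∧ ENNReal.ofReal (w * (n : ℝ) ^ ((5 : ℝ) / 2)) ≤ kP P} ≤
      ((matBall n (H ^ 2)).filter fun X => ∃ j,
      |pairing (u j (Function.update X j 0)) (X j)| ≤ H / (w * (n : ℝ) ^ 2)).card := by
    rw [hbad]
    refine Finset.card_le_card fun A hA => ?_
    obtain ⟨hAH, hA, hk⟩ := (@Finset.mem_filter _ _ (_) _ _).1 hA
    refine Finset.mem_filter.2 ⟨hAH, ?_⟩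
    obtain ⟨j, hj⟩ := hA.exists_row_near (by omega) hw0 hk
      (fun j => u j (Function.update A j 0)) (fun j => hu _ _) (fun j i hij => by
        simpa [Function.update_of_ne hij] using hperp j (Function.update A j 0) i hij)
    refine ⟨j, ?_⟩
    rw [pairing_apply, le_div_iff₀ (by positivity)]
    exact hj.trans ((frobNorm_le_iff_mem_matBall hH.le).2 hAH)
  rw [← hall] at hprim
  have hsub' := mul_le_mul_of_nonneg_left (Nat.cast_le (α := ℝ).2 hsub) hw0.le
  push_cast at hsub' hprim
  linarith

/-- A nonzero `1 × 1` matrix is perfectly conditioned. -/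
theorem not_ill_conditioned_one (hw : 1 < w) (hH : 0 ≤ H)
    {P : Projectivization ℚ (Matrix (Fin 1) (Fin 1) ℚ)} (hP : heightLE P H) :
    ¬ ENNReal.ofReal (w * ((1 : ℕ) : ℝ) ^ ((5 : ℝ) / 2)) ≤ kP P := by
  obtain ⟨A, -, hA, rfl⟩ := (heightLE_iff hH).1 hP
  intro hk
  obtain ⟨j, hj⟩ := hA.exists_row_near le_rfl (by linarith) hk (fun _ _ => 1) (by simp)
    (fun j i hij => absurd (Subsingleton.elim i j) hij)
  have hfrob : frobNorm (Matrix.map A (Int.cast : ℤ → ℝ)) = |(A 0 0 : ℝ)| := by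
    rw [← Real.sqrt_sq_eq_abs, frobNorm, Fin.sum_univ_one, Fin.sum_univ_one]
    rfl
  rw [hfrob, Fin.sum_univ_one, Subsingleton.elim j 0] at hj
  have hA0 : (A 0 0 : ℝ) ≠ 0 := by
    intro h0
    refine hA.map_ne_zero ?_
    ext i k
    rw [map_intCast_apply, Subsingleton.elim i 0, Subsingleton.elim k 0]
    simpa using h0
  have := abs_pos.2 hA0
  simp only [one_mul, Nat.cast_one, one_pow, mul_one] at hj
  nlinarith

end Conclusion

/-- Main Theorem for Linear Algebra: there is a universal constant
`c₁ ≤ 10` such that for all `n ≥ 1` and all `h, w > 0` with `w > 1` and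
`h ≥ c₁·n⁴·log n + log w`, among the points of `ℙ(M_n(ℚ))` of bit length at most `h`,
the number of points with condition number `k ≥ w·n^{5/2}` is at most `2/w` times the
total number of such points. -/
theorem main_theorem_linear_algebra :
    ∃ c₁ : ℝ, 0 < c₁ ∧ c₁ ≤ 10 ∧
      ∀ (n : ℕ), 1 ≤ n → ∀ h w : ℝ, 0 < h → 1 < w →
        c₁ * (n : ℝ) ^ 4 * Real.log n + Real.log w ≤ h →
        (Set.ncard {P : Projectivization ℚ (Matrix (Fin n) (Fin n) ℚ) |
            heightLE P ((2 : ℝ) ^ h) ∧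
              ENNReal.ofReal (w * (n : ℝ) ^ ((5 : ℝ) / 2)) ≤ kP P} : ℝ) ≤
          (2 / w) *
            (Set.ncard {P : Projectivization ℚ (Matrix (Fin n) (Fin n) ℚ) |
              heightLE P ((2 : ℝ) ^ h)} : ℝ) := by
  refine ⟨10, by norm_num, le_rfl, fun n hn h w _ hw hbound => ?_⟩
  have hw0 : 0 < w := by linarith
  have hH : (0 : ℝ) < 2 ^ h := by positivity
  obtain rfl | hn2 : n = 1 ∨ 2 ≤ n := by omega
  · rw [show {P : Projectivization ℚ (Matrix (Fin 1) (Fin 1) ℚ) | heightLE P ((2 : ℝ) ^ h) ∧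
        ENNReal.ofReal (w * ((1 : ℕ) : ℝ) ^ ((5 : ℝ) / 2)) ≤ kP P} = ∅ from
      Set.eq_empty_of_forall_notMem fun P hP => not_ill_conditioned_one hw hH.le hP.1 hP.2]
    simp only [Set.ncard_empty, Nat.cast_zero]
    positivity
  · have hlog : Real.log 2 * (10 * (n : ℝ) ^ 4 * Real.log n + Real.log w) ≤
        Real.log ((2 : ℝ) ^ h) := by
      rw [Real.log_rpow (by norm_num), mul_comm h]
      gcongr
    have := mul_ncard_ill_conditioned_le hn2 hw hH hlog
    rw [div_mul_eq_mul_div, le_div_iff₀ hw0]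
    linarith

end
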